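/- arXiv:1202.0123 — 2 statements merged into one kernel-verified Lean document; each statement's English description precedes it below -/
import Mathlib

section
/- Let g be a finite-dimensional simple Lie algebra over ℂ, let n be a positive integer, and let V_1, …, V_n and W_1, …, W_n be finite-dimensional irreducible g-modules (trivial modules allowed) such that V_1 ⊗ V_2 ⊗ ⋯ ⊗ V_n ≅ W_1 ⊗ W_2 ⊗ ⋯ ⊗ W_n as g-modules. Then there is a permutation σ of {1, …, n} such that V_i ≅ W_{σ(i)} as g-modules for all 1 ≤ i ≤ n. -/
open scoped TensorProduct

/-- A bundled Lie module over the Lie algebra `L` (over `ℂ`). -/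
structure LieModuleObj (L : Type*) [LieRing L] [LieAlgebra ℂ L] where
  carrier : Type
  [isAddCommGroup : AddCommGroup carrier]
  [isModule : Module ℂ carrier]
  [isLieRingModule : LieRingModule L carrier]
  [isLieModule : LieModule ℂ L carrier]

attribute [instance] LieModuleObj.isAddCommGroup LieModuleObj.isModule
  LieModuleObj.isLieRingModule LieModuleObj.isLieModule

variable {L : Type*} [LieRing L] [LieAlgebra ℂ L]

/-- The trivial one-dimensional module `ℂ` (serving as the empty tensor product). -/
noncomputable def LieModuleObj.unit (L : Type*) [LieRing L] [LieAlgebra ℂ L] :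
    LieModuleObj L :=
  letI inst : LieRingModule L ℂ :=
    { bracket := fun _ _ => 0
      add_lie := by simp
      lie_add := by simp
      leibniz_lie := by simp }
  { carrier := ℂ
    isLieRingModule := inst
    isLieModule :=
      { smul_lie := fun c x m => by show (0 : ℂ) = c • (0 : ℂ); simp
        lie_smul := fun c x m => by show (0 : ℂ) = c • (0 : ℂ); simp } }

/-- The tensor product (over `ℂ`) of two bundled Lie modules, with the usual action
`x·(v ⊗ w) = (x·v) ⊗ w + v ⊗ (x·w)`. -/
noncomputable def LieModuleObj.tensor (M N : LieModuleObj L) : LieModuleObj L where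
  carrier := M.carrier ⊗[ℂ] N.carrier

/-- The iterated tensor product `V 0 ⊗ V 1 ⊗ ⋯ ⊗ V (n-1)` of a family of bundled Lie
modules. -/
noncomputable def LieModuleObj.tensorAll :
    (n : ℕ) → (Fin n → LieModuleObj L) → LieModuleObj L
  | 0, _ => LieModuleObj.unit L
  | n + 1, V => (LieModuleObj.tensorAll n fun i => V i.castSucc).tensor (V (Fin.last n))

namespace UF
namespace Comb
open MvPowerSeries
open scoped ComplexOrder

variable {ι : Type*}

/-- The log-derivation `X_v ∂/∂X_v` on power series. -/
noncomputable def D (v : ι) : MvPowerSeries ι ℂ →ₗ[ℂ] MvPowerSeries ι ℂ where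
  toFun f := fun β => (β v : ℂ) * coeff β f
  map_add' f g := by
    ext β
    change (β v : ℂ) * coeff β (f + g) = (β v : ℂ) * coeff β f + (β v : ℂ) * coeff β g
    rw [map_add, mul_add]
  map_smul' c f := by
    ext β
    change (β v : ℂ) * coeff β (c • f) = c * ((β v : ℂ) * coeff β f)
    rw [map_smul, smul_eq_mul]; ring

lemma coeff_D (v : ι) (f : MvPowerSeries ι ℂ) (β : ι →₀ ℕ) :
    coeff β (D v f) = (β v : ℂ) * coeff β f := rfl

lemma D_mul (v : ι) (f g : MvPowerSeries ι ℂ) : D v (f * g) = D v f * g + f * D v g := by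
  classical
  ext β
  rw [coeff_D, map_add, coeff_mul, coeff_mul, coeff_mul, Finset.mul_sum, ← Finset.sum_add_distrib]
  refine Finset.sum_congr rfl fun p hp => ?_
  rw [coeff_D, coeff_D, ← Finset.HasAntidiagonal.mem_antidiagonal.1 hp]
  simp only [Finsupp.add_apply, Nat.cast_add]
  ring

/-- The logarithmic derivative. -/
noncomputable def lgd (v : ι) (f : MvPowerSeries ι ℂ) : MvPowerSeries ι ℂ := D v f * f⁻¹

lemma lgd_mul (v : ι) {f g : MvPowerSeries ι ℂ} (hf : constantCoeff f ≠ 0)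
    (hg : constantCoeff g ≠ 0) : lgd v (f * g) = lgd v f + lgd v g := by
  unfold lgd
  have h1 := MvPowerSeries.mul_inv_cancel f hf
  have h2 := MvPowerSeries.mul_inv_cancel g hg
  rw [D_mul, MvPowerSeries.mul_inv_rev]
  linear_combination (D v f * f⁻¹) * h2 + (D v g * g⁻¹) * h1

lemma lgd_one (v : ι) : lgd v (1 : MvPowerSeries ι ℂ) = 0 := by
  classical
  have : D v (1 : MvPowerSeries ι ℂ) = 0 := by
    ext β
    rw [coeff_D, coeff_one]
    split_ifs with h
    · simp [h]
    · simp
  rw [lgd, this, zero_mul]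

lemma lgd_prod (v : ι) {κ : Type*} (s : Finset κ) (f : κ → MvPowerSeries ι ℂ)
    (hf : ∀ j ∈ s, constantCoeff (f j) = 1) : lgd v (∏ j ∈ s, f j) = ∑ j ∈ s, lgd v (f j) := by
  classical
  induction s using Finset.induction_on with
  | empty => simp [lgd_one]
  | insert a s ha ih =>
    rw [Finset.prod_insert ha, Finset.sum_insert ha, lgd_mul, ih]
    · exact fun j hj => hf j (Finset.mem_insert_of_mem hj)
    · rw [hf a (Finset.mem_insert_self _ _)]; exact one_ne_zero
    · rw [map_prod, Finset.prod_congr rfl fun j hj => hf j (Finset.mem_insert_of_mem hj)]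
      simp

/-- Admissible series: exponents at `i` are `0` or at least `a i`. -/
def Adm (a : ι → ℕ) (f : MvPowerSeries ι ℂ) : Prop :=
  ∀ β, coeff β f ≠ 0 → ∀ i, β i = 0 ∨ a i ≤ β i

lemma Adm.mul {a : ι → ℕ} {f g : MvPowerSeries ι ℂ} (hf : Adm a f) (hg : Adm a g) :
    Adm a (f * g) := by
  classical
  intro β hβ i
  rw [coeff_mul] at hβ
  obtain ⟨p, hp, hne⟩ := Finset.exists_ne_zero_of_sum_ne_zero hβ
  have h1 := hf p.1 (left_ne_zero_of_mul hne) i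
  have h2 := hg p.2 (right_ne_zero_of_mul hne) i
  have : β i = p.1 i + p.2 i := by rw [← Finset.HasAntidiagonal.mem_antidiagonal.1 hp]; rfl
  omega

lemma Adm.D {a : ι → ℕ} {f : MvPowerSeries ι ℂ} (v : ι) (hf : Adm a f) : Adm a (D v f) := by
  intro β hβ
  rw [coeff_D] at hβ
  exact hf β (right_ne_zero_of_mul hβ)

lemma Adm.inv [Finite ι] {a : ι → ℕ} {f : MvPowerSeries ι ℂ} (hf : Adm a f) : Adm a f⁻¹ := by
  classical
  intro β
  induction β using WellFoundedLT.induction with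
  | ind β ih =>
    intro hβ i
    rw [coeff_inv] at hβ
    split_ifs at hβ with h0
    · left; simp [h0]
    obtain ⟨p, hp, hne⟩ := Finset.exists_ne_zero_of_sum_ne_zero (right_ne_zero_of_mul hβ)
    split_ifs at hne with hlt
    · have h1 := hf p.1 (left_ne_zero_of_mul hne) i
      have h2 := ih p.2 hlt (right_ne_zero_of_mul hne) i
      have : β i = p.1 i + p.2 i := by rw [← Finset.HasAntidiagonal.mem_antidiagonal.1 hp]; rfl
      omega
    · exact absurd rfl hne

section fin
variable [Fintype ι] [DecidableEq ι]

/-- The exponent `∑_{i ∈ I} a_i e_i`. -/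
noncomputable def ex (a : ι → ℕ) (I : Finset ι) : ι →₀ ℕ :=
  Finsupp.equivFunOnFinite.symm fun i => if i ∈ I then a i else 0

@[simp] lemma ex_apply (a : ι → ℕ) (I : Finset ι) (i : ι) :
    ex a I i = if i ∈ I then a i else 0 := rfl

lemma ex_inj {a : ι → ℕ} (ha : ∀ i, 0 < a i) {I J : Finset ι} (h : ex a I = ex a J) : I = J := by
  ext i
  have := DFunLike.congr_fun h i
  have := ha i
  simp only [ex_apply] at *
  split_ifs at * <;> simp_all <;> omega

@[simp] lemma ex_empty (a : ι → ℕ) : ex a ∅ = 0 := by ext i; simp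

lemma ex_add (a : ι → ℕ) {I J : Finset ι} (h : Disjoint I J) : ex a I + ex a J = ex a (I ∪ J) := by
  ext i
  have : i ∈ I → i ∉ J := fun h1 h2 => Finset.disjoint_left.1 h h1 h2
  simp only [Finsupp.add_apply, ex_apply, Finset.mem_union]
  by_cases h1 : i ∈ I <;> by_cases h2 : i ∈ J <;> simp_all

/-- multilinear coefficients multiply by subset convolution -/
lemma coeff_ex_mul {a : ι → ℕ} (ha : ∀ i, 0 < a i) {f g : MvPowerSeries ι ℂ} (hf : Adm a f)
    (hg : Adm a g) (I : Finset ι) :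
    coeff (ex a I) (f * g) =
      ∑ J ∈ I.powerset, coeff (ex a J) f * coeff (ex a (I \ J)) g := by
  rw [coeff_mul]
  symm
  refine Finset.sum_of_injOn (fun J => (ex a J, ex a (I \ J))) ?_ ?_ ?_ ?_
  · intro J _ K _ h
    exact ex_inj ha (Prod.ext_iff.1 h).1
  · intro J hJ
    have hJ' : J ⊆ I := by simpa using hJ
    simp only [Finset.mem_coe, Finset.HasAntidiagonal.mem_antidiagonal]
    rw [ex_add _ Finset.disjoint_sdiff, Finset.union_sdiff_of_subset hJ']
  · rintro ⟨p, q⟩ hpq hnot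
    by_contra hne
    apply hnot
    have h1 := hf p (left_ne_zero_of_mul hne)
    have h2 := hg q (right_ne_zero_of_mul hne)
    have h3 : ∀ i, p i + q i = if i ∈ I then a i else 0 := fun i => by
      have := DFunLike.congr_fun (Finset.HasAntidiagonal.mem_antidiagonal.1 hpq) i
      simpa using this
    refine ⟨Finset.univ.filter fun i => p i ≠ 0, ?_, ?_⟩
    · simp only [Finset.coe_powerset, Set.mem_preimage, Set.mem_powerset_iff, Finset.coe_subset]
      intro i hi
      have := h3 i
      by_contra hI
      have hi' : p i ≠ 0 := by simpa using hi
      rw [if_neg hI] at this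
      omega
    · ext i
      · have := h3 i; have := h1 i; have := h2 i; have := ha i
        simp only [ex_apply, Finset.mem_filter, Finset.mem_univ, true_and]
        split_ifs at * <;> omega
      · have := h3 i; have := h1 i; have := h2 i; have := ha i
        simp only [ex_apply, Finset.mem_sdiff, Finset.mem_filter, Finset.mem_univ, true_and]
        by_cases hI : i ∈ I <;> by_cases hp0 : p i = 0 <;> simp [hI, hp0] at * <;> omega
  · intros; rfl

lemma coeff_ex_one {a : ι → ℕ} (ha : ∀ i, 0 < a i) (I : Finset ι) :
    coeff (ex a I) (1 : MvPowerSeries ι ℂ) = if I = ∅ then 1 else 0 := by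
  rw [coeff_one]
  congr 1
  rw [← ex_empty a]
  exact propext ⟨fun h => ex_inj ha h, fun h => by rw [h]⟩

/-- the multilinear coefficients of the inverse only depend on those of the series -/
lemma coeff_ex_inv {a b : ι → ℕ} (ha : ∀ i, 0 < a i) (hb : ∀ i, 0 < b i)
    {f g : MvPowerSeries ι ℂ} (hf : Adm a f) (hg : Adm b g)
    (hf1 : constantCoeff f = 1) (hg1 : constantCoeff g = 1)
    (h : ∀ I, coeff (ex a I) f = coeff (ex b I) g) (I : Finset ι) :
    coeff (ex a I) f⁻¹ = coeff (ex b I) g⁻¹ := by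
  induction I using Finset.strongInduction with
  | H I ih =>
    have e1 := coeff_ex_mul ha hf hf.inv I
    have e2 := coeff_ex_mul hb hg hg.inv I
    rw [MvPowerSeries.mul_inv_cancel _ (by rw [hf1]; exact one_ne_zero), coeff_ex_one ha] at e1
    rw [MvPowerSeries.mul_inv_cancel _ (by rw [hg1]; exact one_ne_zero), coeff_ex_one hb] at e2
    rw [e1] at e2
    rw [← Finset.add_sum_erase _ _ (Finset.empty_mem_powerset I),
      ← Finset.add_sum_erase _ _ (Finset.empty_mem_powerset I)] at e2
    have e3 : ∑ J ∈ I.powerset.erase ∅, coeff (ex a J) f * coeff (ex a (I \ J)) f⁻¹ =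
        ∑ J ∈ I.powerset.erase ∅, coeff (ex b J) g * coeff (ex b (I \ J)) g⁻¹ := by
      refine Finset.sum_congr rfl fun J hJ => ?_
      rw [Finset.mem_erase, Finset.mem_powerset] at hJ
      rw [h, ih (I \ J) (Finset.sdiff_ssubset hJ.2 (Finset.nonempty_iff_ne_empty.2 hJ.1))]
    rw [e3] at e2
    have e4 := add_right_cancel e2
    simpa [hf1, hg1] using e4

variable (adj : ι → ι → Prop)

open Classical in
/-- sign of an independent set -/
noncomputable def sgn (I : Finset ι) : ℂ :=
  if ∀ i ∈ I, ∀ j ∈ I, ¬ adj i j then (-1) ^ I.card else 0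

/-- Independence polynomial -/
noncomputable def ind (H : Finset ι) : MvPowerSeries ι ℂ :=
  ∑ J ∈ H.powerset, monomial (ex 1 J) (sgn adj J)

lemma coeff_ind (H I : Finset ι) :
    coeff (ex 1 I) (ind adj H) = if I ⊆ H then sgn adj I else 0 := by
  rw [ind, map_sum]
  simp only [coeff_monomial]
  have : ∀ J, (ex 1 I = ex 1 J) ↔ I = J :=
    fun J => ⟨fun h => ex_inj (fun _ => one_pos) h, fun h => by rw [h]⟩
  simp [this]

lemma adm_ind (H : Finset ι) : Adm 1 (ind adj H) := by
  intro β _ i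
  simp only [Pi.one_apply]
  omega

lemma const_ind (H : Finset ι) : constantCoeff (ind adj H) = 1 := by
  have := coeff_ind adj H ∅
  rw [ex_empty, coeff_zero_eq_constantCoeff_apply] at this
  rw [this]; simp [sgn]

lemma ind_inv (H : Finset ι) : ind adj H * (ind adj H)⁻¹ = 1 :=
  MvPowerSeries.mul_inv_cancel _ (by rw [const_ind]; exact one_ne_zero)

variable {adj} (hsymm : ∀ i j, adj i j → adj j i) (hirr : ∀ i, ¬ adj i i)
include hsymm hirr

open Classical in
lemma ind_rec (H : Finset ι) (s : ι) (hs : s ∈ H) :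
    ind adj H = ind adj (H.erase s) - X s * ind adj ((H.erase s).filter fun j => ¬ adj s j) := by
  conv_lhs => rw [← Finset.insert_erase hs]
  rw [ind, Finset.sum_powerset_insert (Finset.notMem_erase s H), ← ind, sub_eq_add_neg]
  congr 1
  rw [ind, Finset.mul_sum, ← Finset.sum_neg_distrib]
  symm
  refine Finset.sum_subset_zero_on_sdiff
    (Finset.powerset_mono.2 (Finset.filter_subset _ _)) ?_ ?_
  · intro J hJ
    rw [Finset.mem_sdiff, Finset.mem_powerset, Finset.mem_powerset] at hJ
    obtain ⟨h1, h2⟩ := hJ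
    obtain ⟨j, hj, hj'⟩ := Finset.not_subset.1 h2
    have : adj s j := by
      by_contra hc
      exact hj' (Finset.mem_filter.2 ⟨h1 hj, hc⟩)
    have : sgn adj (insert s J) = 0 := by
      rw [sgn, if_neg]
      intro hh
      exact hh s (Finset.mem_insert_self _ _) j (Finset.mem_insert_of_mem hj) this
    rw [this, map_zero]
  · intro J hJ
    rw [Finset.mem_powerset] at hJ
    have hsJ : s ∉ J := fun h => by simpa using hJ h
    have hN : ∀ j ∈ J, ¬ adj s j := fun j hj => (Finset.mem_filter.1 (hJ hj)).2
    have e : sgn adj (insert s J) = - sgn adj J := by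
      unfold sgn
      have : (∀ i ∈ insert s J, ∀ j ∈ insert s J, ¬ adj i j) ↔ (∀ i ∈ J, ∀ j ∈ J, ¬ adj i j) := by
        constructor
        · intro h i hi j hj
          exact h i (Finset.mem_insert_of_mem hi) j (Finset.mem_insert_of_mem hj)
        · intro h i hi j hj
          rw [Finset.mem_insert] at hi hj
          rcases hi with rfl | hi <;> rcases hj with rfl | hj
          · exact hirr _
          · exact hN j hj
          · exact fun hh => hN i hi (hsymm _ _ hh)
          · exact h i hi j hj
      simp only [this]
      split_ifs
      · rw [Finset.card_insert_of_notMem hsJ, pow_succ]; ring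
      · simp
    have e2 : ex 1 (insert s J) = Finsupp.single s 1 + ex 1 J := by
      ext i
      by_cases h : i = s
      · subst h; simp [hsJ]
      · simp [h, Finsupp.single_apply, Ne.symm h]
    rw [e, e2, X_def, monomial_mul_monomial, one_mul, map_neg]

/-- All coefficients nonnegative. -/
def NN (f : MvPowerSeries ι ℂ) : Prop := ∀ β, 0 ≤ coeff β f

omit [Fintype ι] hsymm hirr in
lemma NN.mul {f g : MvPowerSeries ι ℂ} (hf : NN f) (hg : NN g) : NN (f * g) := by
  intro β
  rw [coeff_mul]
  exact Finset.sum_nonneg fun p _ => mul_nonneg (hf _) (hg _)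

omit [Fintype ι] hsymm hirr in
lemma NN.add {f g : MvPowerSeries ι ℂ} (hf : NN f) (hg : NN g) : NN (f + g) := by
  intro β
  rw [map_add]
  exact add_nonneg (hf _) (hg _)

omit [Fintype ι] hsymm hirr in
lemma NN.one : NN (1 : MvPowerSeries ι ℂ) := by
  intro β
  rw [coeff_one]
  split_ifs
  · exact zero_le_one
  · exact le_rfl

omit [Fintype ι] hsymm hirr in
lemma NN.X (s : ι) : NN (X s : MvPowerSeries ι ℂ) := by
  intro β
  rw [coeff_X]
  split_ifs
  · exact zero_le_one
  · exact le_rfl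

omit hsymm hirr in
lemma NN.geom {f z : MvPowerSeries ι ℂ} (hz : NN z) (hz0 : constantCoeff z = 0)
    (h : f = 1 + z * f) : NN f := by
  intro β
  induction β using WellFoundedLT.induction with
  | ind β ih =>
    rw [h, map_add, coeff_mul]
    refine add_nonneg (NN.one _) (Finset.sum_nonneg fun p hp => ?_)
    by_cases h0 : p.1 = 0
    · rw [h0, coeff_zero_eq_constantCoeff_apply, hz0, zero_mul]
    · refine mul_nonneg (hz _) (ih _ ?_)
      rw [← Finset.HasAntidiagonal.mem_antidiagonal.1 hp]
      exact lt_add_of_pos_left _ (pos_iff_ne_zero.2 h0)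

variable (adj) in
/-- The ratio `I_{H \ S} / I_H`. -/
noncomputable def rat (H S : Finset ι) : MvPowerSeries ι ℂ := ind adj (H \ S) * (ind adj H)⁻¹

variable (adj) in
open Classical in
/-- neighbours -/
noncomputable def nbr (s : ι) : Finset ι := Finset.univ.filter fun j => adj s j

omit hsymm hirr in
lemma const_rat (H S : Finset ι) : constantCoeff (rat adj H S) = 1 := by
  rw [rat, map_mul, const_ind, constantCoeff_inv, const_ind]; simp

lemma ind_rec' (H : Finset ι) (s : ι) (hs : s ∈ H) :
    ind adj H = ind adj (H.erase s) - X s * ind adj (H.erase s \ nbr adj s) := by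
  classical
  rw [ind_rec hsymm hirr H s hs]
  congr 3
  ext j
  simp [nbr]

lemma rat_single (H : Finset ι) (s : ι) (hs : s ∈ H) :
    rat adj H {s} = 1 + X s * rat adj (H.erase s) (nbr adj s) * rat adj H {s} := by
  have h1 := ind_rec' hsymm hirr H s hs
  have h2 := ind_inv adj H
  have h3 := ind_inv adj (H.erase s)
  unfold rat
  rw [Finset.sdiff_singleton_eq_erase]
  linear_combination
    - (ind adj H)⁻¹ * h1 + h2 - X s * ind adj (H.erase s \ nbr adj s) * (ind adj H)⁻¹ * h3

lemma rat_rec (H S : Finset ι) (s : ι) (hs : s ∈ H) (hsS : s ∈ S) :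
    rat adj H S = rat adj (H.erase s) S *
      (1 + X s * rat adj (H.erase s) (nbr adj s) * rat adj H {s}) := by
  rw [← rat_single hsymm hirr H s hs]
  have h3 := ind_inv adj (H.erase s)
  unfold rat
  rw [Finset.sdiff_singleton_eq_erase]
  have : H.erase s \ S = H \ S := by
    ext j; simp only [Finset.mem_sdiff, Finset.mem_erase]
    constructor
    · rintro ⟨⟨_, h⟩, h'⟩; exact ⟨h, h'⟩
    · rintro ⟨h, h'⟩; exact ⟨⟨fun e => h' (e ▸ hsS), h⟩, h'⟩
  rw [this]
  linear_combination - ind adj (H \ S) * (ind adj H)⁻¹ * h3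

lemma nn_rat (H S : Finset ι) : NN (rat adj H S) := by
  induction H using Finset.strongInduction generalizing S with
  | H H ih =>
    by_cases h : ∃ s ∈ H, s ∈ S
    · obtain ⟨s, hs, hsS⟩ := h
      have hlt : H.erase s ⊂ H := Finset.erase_ssubset hs
      have hz : NN (X s * rat adj (H.erase s) (nbr adj s)) := (NN.X s).mul (ih _ hlt _)
      have hz0 : constantCoeff (X s * rat adj (H.erase s) (nbr adj s)) = 0 := by simp
      rw [rat_rec hsymm hirr H S s hs hsS]
      refine (ih _ hlt _).mul (NN.one.add (hz.mul ?_))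
      exact NN.geom hz hz0 (rat_single hsymm hirr H s hs)
    · have : H \ S = H := by
        rw [Finset.sdiff_eq_self_iff_disjoint, Finset.disjoint_left]
        exact fun a ha hb => h ⟨a, ha, hb⟩
      rw [rat, this, ind_inv]
      exact NN.one

omit [Fintype ι] hsymm hirr in
lemma coeff_mul_pos {f g : MvPowerSeries ι ℂ} (hf : NN f) (hg : NN g) {β γ : ι →₀ ℕ}
    (h1 : 0 < coeff β f) (h2 : 0 < coeff γ g) : 0 < coeff (β + γ) (f * g) := by
  rw [coeff_mul]
  refine lt_of_lt_of_le (mul_pos h1 h2) ?_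
  exact Finset.single_le_sum (f := fun p : (ι →₀ ℕ) × (ι →₀ ℕ) => coeff p.1 f * coeff p.2 g)
    (fun p _ => mul_nonneg (hf _) (hg _))
    (Finset.HasAntidiagonal.mem_antidiagonal.2 rfl : (β, γ) ∈ Finset.HasAntidiagonal.antidiagonal (β + γ))

variable (adj) in
/-- every union of components of `T` meets `S` -/
def Conn (T S : Finset ι) : Prop :=
  ∀ C ⊆ T, C.Nonempty → (∀ i ∈ C, ∀ j ∈ T, adj i j → j ∈ C) → ∃ i ∈ C, i ∈ S

lemma rat_pos (H S T : Finset ι) (hT : T ⊆ H) (hc : Conn adj T S) :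
    0 < coeff (ex 1 T) (rat adj H S) := by
  classical
  induction H using Finset.strongInduction generalizing S T with
  | H H ih =>
    by_cases hT0 : T = ∅
    · rw [hT0, ex_empty, coeff_zero_eq_constantCoeff_apply, const_rat]; exact one_pos
    obtain ⟨s, hsT, hsS⟩ := hc T subset_rfl (Finset.nonempty_iff_ne_empty.2 hT0)
      (fun _ _ j hj _ => hj)
    have hs := hT hsT
    have hlt : H.erase s ⊂ H := Finset.erase_ssubset hs
    -- the part of `T \ s` not connected to `s`
    let A : Finset ι := ((T.erase s).powerset.filter fun C =>
      (∀ i ∈ C, ∀ j ∈ T.erase s, adj i j → j ∈ C) ∧ ∀ i ∈ C, ¬ adj s i).biUnion id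
    have hA : ∀ i, i ∈ A ↔ ∃ C ⊆ T.erase s,
        ((∀ i ∈ C, ∀ j ∈ T.erase s, adj i j → j ∈ C) ∧ ∀ i ∈ C, ¬ adj s i) ∧ i ∈ C := by
      intro i
      simp only [A, Finset.mem_biUnion, Finset.mem_filter, Finset.mem_powerset, id]
      constructor
      · rintro ⟨C, ⟨h1, h2⟩, h3⟩; exact ⟨C, h1, h2, h3⟩
      · rintro ⟨C, h1, h2, h3⟩; exact ⟨C, ⟨h1, h2⟩, h3⟩
    have hAT : A ⊆ T.erase s := fun i hi => by
      obtain ⟨C, h1, _, h3⟩ := (hA i).1 hi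
      exact h1 h3
    have hAcl : ∀ i ∈ A, ∀ j ∈ T.erase s, adj i j → j ∈ A := by
      intro i hi j hj hij
      obtain ⟨C, h1, h2, h3⟩ := (hA i).1 hi
      exact (hA j).2 ⟨C, h1, h2, h2.1 i h3 j hj hij⟩
    have hAs : ∀ i ∈ A, ¬ adj s i := fun i hi => by
      obtain ⟨C, h1, h2, h3⟩ := (hA i).1 hi
      exact h2.2 i h3
    let B := T.erase s \ A
    have hTe : T.erase s ⊆ H.erase s := Finset.erase_subset_erase _ hT
    have pA : 0 < coeff (ex 1 A) (rat adj (H.erase s) S) := by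
      refine ih _ hlt S A (hAT.trans hTe) ?_
      intro C hC hne hcl
      refine hc C ((hC.trans hAT).trans (Finset.erase_subset _ _)) hne ?_
      intro i hi j hj hij
      by_cases hjs : j = s
      · subst hjs; exact absurd (hsymm _ _ hij) (hAs i (hC hi))
      · exact hcl i hi j (hAcl i (hC hi) j (Finset.mem_erase.2 ⟨hjs, hj⟩) hij) hij
    have pB : 0 < coeff (ex 1 B) (rat adj (H.erase s) (nbr adj s)) := by
      refine ih _ hlt _ B (Finset.sdiff_subset.trans hTe) ?_
      intro C hC hne hcl
      by_contra hno
      push Not at hno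
      obtain ⟨i, hi⟩ := hne
      have hiB := Finset.mem_sdiff.1 (hC hi)
      apply hiB.2
      refine (hA i).2 ⟨C, hC.trans Finset.sdiff_subset, ⟨?_, ?_⟩, hi⟩
      · intro k hk j hj hkj
        refine hcl k hk j (Finset.mem_sdiff.2 ⟨hj, fun hjA => ?_⟩) hkj
        exact (Finset.mem_sdiff.1 (hC hk)).2
          (hAcl j hjA k (Finset.mem_sdiff.1 (hC hk)).1 (hsymm _ _ hkj))
      · intro k hk hsk
        exact hno k hk (by simp [nbr, hsk])
    have hz : NN (X s * rat adj (H.erase s) (nbr adj s)) := (NN.X s).mul (nn_rat hsymm hirr _ _)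
    have p1 : 0 < coeff (Finsupp.single s 1) (X s : MvPowerSeries ι ℂ) := by
      rw [coeff_index_single_self_X]; exact one_pos
    have p2 := coeff_mul_pos (NN.X s) (nn_rat hsymm hirr _ _) p1 pB
    have p3 : 0 < coeff 0 (rat adj H {s}) := by
      rw [coeff_zero_eq_constantCoeff_apply, const_rat]; exact one_pos
    have p4 := coeff_mul_pos hz (nn_rat hsymm hirr H {s}) p2 p3
    have p5 := coeff_mul_pos (nn_rat hsymm hirr (H.erase s) S)
      (hz.mul (nn_rat hsymm hirr H {s})) pA p4
    have e : ex 1 A + (Finsupp.single s 1 + ex 1 B + 0) = ex 1 T := by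
      ext i
      have h1 : i ∈ A → i ≠ s ∧ i ∈ T := fun h => Finset.mem_erase.1 (hAT h)
      by_cases his : i = s
      · subst his
        have : i ∉ A := fun h => (h1 h).1 rfl
        simp [B, this, hsT]
      · by_cases hiA : i ∈ A
        · simp [B, hiA, (h1 hiA).2, Finsupp.single_apply, Ne.symm his]
        · simp [B, hiA, his, Finsupp.single_apply, Ne.symm his]
    rw [e] at p5
    rw [rat_rec hsymm hirr H S s hs hsS, mul_add, mul_one, map_add]
    exact add_pos_of_nonneg_of_pos (nn_rat hsymm hirr _ _ _) p5

omit hsymm hirr in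
lemma D_ind_of_notMem (H : Finset ι) (v : ι) (hv : v ∉ H) : D v (ind adj H) = 0 := by
  rw [ind, map_sum]
  refine Finset.sum_eq_zero fun J hJ => ?_
  have hvJ : v ∉ J := fun h => hv (Finset.mem_powerset.1 hJ h)
  ext β
  rw [coeff_D, coeff_monomial]
  split_ifs with h
  · simp [h, hvJ]
  · simp

/-- the crucial constant is nonzero -/
lemma lgd_ind_ne_zero (v : ι) (hc : Conn adj (Finset.univ.erase v) (nbr adj v)) :
    coeff (ex 1 Finset.univ) (lgd v (ind adj Finset.univ)) ≠ 0 := by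
  have hD : D v (ind adj Finset.univ) = - (X v * ind adj (Finset.univ.erase v \ nbr adj v)) := by
    rw [ind_rec' hsymm hirr _ v (Finset.mem_univ v), map_sub, D_ind_of_notMem _ _ (by simp), D_mul,
      D_ind_of_notMem _ v (by simp)]
    have : D v (X v : MvPowerSeries ι ℂ) = X v := by
      ext β
      rw [coeff_D, coeff_X]
      split_ifs with h
      · simp [h]
      · simp
    rw [this]; ring
  have hl : lgd v (ind adj Finset.univ) =
      - (X v * rat adj Finset.univ (insert v (nbr adj v))) := by
    rw [lgd, hD, rat]
    have : Finset.univ.erase v \ nbr adj v = Finset.univ \ insert v (nbr adj v) := by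
      ext j; simp
    rw [this]; ring
  rw [hl, map_neg, neg_ne_zero]
  have e : ex 1 (Finset.univ : Finset ι) = Finsupp.single v 1 + ex 1 (Finset.univ.erase v) := by
    ext i
    by_cases h : i = v
    · subst h; simp
    · simp [h, Finsupp.single_apply, Ne.symm h]
  rw [e]
  refine (coeff_mul_pos (NN.X v) (nn_rat hsymm hirr _ _) ?_ ?_).ne'
  · rw [coeff_index_single_self_X]; exact one_pos
  · refine rat_pos hsymm hirr _ _ _ (Finset.subset_univ _) ?_
    intro C h1 h2 h3
    obtain ⟨i, hi, hi'⟩ := hc C h1 h2 h3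
    exact ⟨i, hi, Finset.mem_insert_of_mem hi'⟩

variable (adj) in
/-- The two properties of the normalized Weyl numerator. -/
structure Good (a : ι → ℕ) (P : MvPowerSeries ι ℂ) : Prop where
  pos : ∀ i, 0 < a i
  adm : Adm a P
  coeff_ex : ∀ I, coeff (ex a I) P = sgn adj I

omit hsymm hirr in
lemma Good.const {a : ι → ℕ} {P : MvPowerSeries ι ℂ} (h : Good adj a P) :
    constantCoeff P = 1 := by
  have := h.coeff_ex ∅
  rw [ex_empty, coeff_zero_eq_constantCoeff_apply] at this
  rw [this]; simp [sgn]

omit hsymm hirr in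
lemma Good.coeff_lgd {a : ι → ℕ} {P : MvPowerSeries ι ℂ} (h : Good adj a P) (v : ι) :
    coeff (ex a Finset.univ) (lgd v P) =
      a v * coeff (ex 1 Finset.univ) (lgd v (ind adj Finset.univ)) := by
  have h1 : ∀ i, 0 < (1 : ι → ℕ) i := fun _ => one_pos
  have hind := adm_ind adj Finset.univ
  have hcoef : ∀ I, coeff (ex a I) P = coeff (ex 1 I) (ind adj Finset.univ) := fun I => by
    rw [h.coeff_ex, coeff_ind, if_pos (Finset.subset_univ _)]
  rw [lgd, lgd, coeff_ex_mul h.pos (h.adm.D v) h.adm.inv,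
    coeff_ex_mul h1 (hind.D v) hind.inv, Finset.mul_sum]
  refine Finset.sum_congr rfl fun J _ => ?_
  rw [coeff_D, coeff_D, hcoef, coeff_ex_inv h.pos h1 h.adm hind h.const (const_ind _ _) hcoef]
  simp only [ex_apply]
  split_ifs
  · simp; ring
  · simp

omit hsymm hirr in
lemma Good.lgd_ne {a : ι → ℕ} {P : MvPowerSeries ι ℂ} (h : Good adj a P) (v : ι)
    {x : ι → ℕ} (hx : ∀ i, 0 < x i) (hne : coeff (ex x Finset.univ) (lgd v P) ≠ 0) : a ≤ x := by
  intro i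
  have := ((h.adm.D v).mul h.adm.inv) _ hne i
  have := hx i
  simp at *
  omega

theorem comb_aux (v : ι) (hc : Conn adj (Finset.univ.erase v) (nbr adj v))
    (PP : (ι → ℕ) → MvPowerSeries ι ℂ) (S : Finset (ι → ℕ)) (hS : ∀ x ∈ S, Good adj x (PP x))
    (c : (ι → ℕ) → ℤ) (h : ∑ x ∈ S, (c x : ℂ) • lgd v (PP x) = 0) : ∀ x ∈ S, c x = 0 := by
  classical
  by_contra! hcon
  have hne : (S.filter fun x => c x ≠ 0).Nonempty := by
    obtain ⟨x, hx, hx'⟩ := hcon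
    exact ⟨x, Finset.mem_filter.2 ⟨hx, hx'⟩⟩
  obtain ⟨x, hx⟩ := (S.filter fun x => c x ≠ 0).exists_minimal hne
  obtain ⟨hxS, hcx⟩ := Finset.mem_filter.1 hx.1
  have e := congrArg (coeff (ex x Finset.univ)) h
  rw [map_sum, map_zero, Finset.sum_eq_single_of_mem x hxS] at e
  · rw [map_smul, smul_eq_mul, (hS x hxS).coeff_lgd v] at e
    have := lgd_ind_ne_zero hsymm hirr v hc
    have h2 := (hS x hxS).pos v
    simp_all
  · intro y hy hyx
    by_cases hcy : c y = 0
    · simp [hcy]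
    rw [map_smul, smul_eq_mul]
    by_contra hne
    have := (hS y hy).lgd_ne v (hS x hxS).pos (right_ne_zero_of_mul hne)
    exact hyx (le_antisymm this (hx.2 (Finset.mem_filter.2 ⟨hy, hcy⟩) this))

theorem comb (v : ι) (hc : Conn adj (Finset.univ.erase v) (nbr adj v)) {n : ℕ}
    (a b : Fin n → ι → ℕ) (P Q : Fin n → MvPowerSeries ι ℂ)
    (hP : ∀ j, Good adj (a j) (P j)) (hQ : ∀ j, Good adj (b j) (Q j))
    (hPP : ∀ j k, a j = a k → P j = P k) (hQQ : ∀ j k, b j = b k → Q j = Q k)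
    (hPQ : ∀ j k, a j = b k → P j = Q k) (h : ∏ j, P j = ∏ j, Q j) :
    ∃ σ : Equiv.Perm (Fin n), ∀ i, a i = b (σ i) := by
  classical
  let PP : (ι → ℕ) → MvPowerSeries ι ℂ := fun x =>
    if h : ∃ j, a j = x then P h.choose else if h : ∃ j, b j = x then Q h.choose else 0
  have h1 : ∀ j, PP (a j) = P j := fun j => by
    have hh : ∃ k, a k = a j := ⟨j, rfl⟩
    simp only [PP]
    rw [dif_pos hh]
    exact hPP _ _ hh.choose_spec
  have h2 : ∀ j, PP (b j) = Q j := fun j => by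
    simp only [PP]
    split_ifs with h3 h4
    · exact hPQ _ _ h3.choose_spec
    · exact hQQ _ _ h4.choose_spec
    · exact absurd ⟨j, rfl⟩ h4
  let S : Finset (ι → ℕ) := Finset.univ.image a ∪ Finset.univ.image b
  have ha : ∀ j, a j ∈ S := fun j => Finset.mem_union_left _ (by simp)
  have hb : ∀ j, b j ∈ S := fun j => Finset.mem_union_right _ (by simp)
  have hS : ∀ x ∈ S, Good adj x (PP x) := by
    intro x hx
    rcases Finset.mem_union.1 hx with hx | hx <;>
    · obtain ⟨j, _, rfl⟩ := Finset.mem_image.1 hx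
      first
      | (rw [h1]; exact hP j)
      | (rw [h2]; exact hQ j)
  have key : ∑ j, lgd v (P j) = ∑ j, lgd v (Q j) := by
    rw [← lgd_prod _ _ _ fun j _ => (hP j).const, ← lgd_prod _ _ _ fun j _ => (hQ j).const, h]
  have cnt : ∀ (f : Fin n → ι → ℕ), (∀ j, f j ∈ S) → ∑ j, lgd v (PP (f j)) =
      ∑ x ∈ S, (((Finset.univ.filter fun j => f j = x).card : ℤ) : ℂ) • lgd v (PP x) := by
    intro f hf
    rw [← Finset.sum_fiberwise_of_maps_to (s := Finset.univ) (t := S) (g := f) (fun j _ => hf j)]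
    refine Finset.sum_congr rfl fun x _ => ?_
    rw [Finset.sum_congr rfl fun j hj => by rw [(Finset.mem_filter.1 hj).2], Finset.sum_const]
    simp [Nat.cast_smul_eq_nsmul]
  have hz := comb_aux hsymm hirr v hc PP S hS
    (fun x => ((Finset.univ.filter fun j => a j = x).card : ℤ) -
      ((Finset.univ.filter fun j => b j = x).card : ℤ)) (by
      have e1 := cnt a ha
      have e2 := cnt b hb
      simp only [h1] at e1
      simp only [h2] at e2
      rw [e1, e2] at key
      simp only [Int.cast_sub, sub_smul, Finset.sum_sub_distrib]
      rw [key, sub_self])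
  have hcard : ∀ x, Fintype.card {j // a j = x} = Fintype.card {j // b j = x} := by
    intro x
    rw [Fintype.card_subtype, Fintype.card_subtype]
    by_cases hx : x ∈ S
    · have := hz x hx
      omega
    · rw [Finset.filter_false_of_mem, Finset.filter_false_of_mem]
      · rintro j _ rfl; exact hx (hb j)
      · rintro j _ rfl; exact hx (ha j)
  let E : ∀ x, {j // a j = x} ≃ {j // b j = x} := fun x => Fintype.equivOfCardEq (hcard x)
  refine ⟨(Equiv.sigmaFiberEquiv a).symm.trans
    ((Equiv.sigmaCongrRight E).trans (Equiv.sigmaFiberEquiv b)), fun i => ?_⟩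
  simp only [Equiv.trans_apply]
  exact ((E (a i)) ⟨i, rfl⟩).2.symm

end fin
end Comb
end UF

namespace UF

/-- Abstract root datum. -/
structure RD (E ι : Type*) [AddCommGroup E] [Module ℂ E] [Fintype ι] where
  α : ι → E
  pos : Finset E
  B : LinearMap.BilinForm ℂ E
  co : ι → E →ₗ[ℂ] ℂ
  d : ι → ℝ
  A : ι → ι → ℤ
  li : LinearIndependent ℂ α
  Bsymm : ∀ x y, B x y = B y x
  d_pos : ∀ i, 0 < d i
  B_α : ∀ i μ, B μ (α i) = co i μ * d i
  co_α : ∀ i j, co i (α j) = A i j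
  A_self : ∀ i, A i i = 2
  A_nonpos : ∀ i j, i ≠ j → A i j ≤ 0
  pos_mem : ∀ x ∈ pos, ∃ c : ι →₀ ℕ, c ≠ 0 ∧ x = ∑ i, (c i : ℂ) • α i
  simple_mem : ∀ i, α i ∈ pos
  perm : ∀ i, ∀ x ∈ pos, x ≠ α i → x - co i x • α i ∈ pos
  definite : ∀ c : ι →₀ ℕ, (∀ i, ∑ j, A i j * (c j : ℤ) ≤ 0) → c = 0

namespace RD

variable {E ι : Type*} [AddCommGroup E] [Module ℂ E] [Fintype ι] [DecidableEq ι] (D : RD E ι)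

/-- the root lattice cone -/
noncomputable def q : (ι →₀ ℕ) →+ E where
  toFun c := ∑ i, (c i : ℂ) • D.α i
  map_zero' := by simp
  map_add' x y := by simp [add_smul, Finset.sum_add_distrib]

omit [DecidableEq ι] in
lemma q_apply (c : ι →₀ ℕ) : D.q c = ∑ i, (c i : ℂ) • D.α i := rfl

omit [DecidableEq ι] in
lemma q_inj : Function.Injective D.q := by
  intro x y h
  rw [q_apply, q_apply, ← sub_eq_zero, ← Finset.sum_sub_distrib] at h
  simp only [← sub_smul] at h
  have := Fintype.linearIndependent_iff.1 D.li _ h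
  ext i
  have := this i
  rw [sub_eq_zero] at this
  exact_mod_cast this

omit [DecidableEq ι] in
lemma eq_zero_of_q_add {x y : ι →₀ ℕ} (h : D.q x + D.q y = 0) : x = 0 := by
  rw [← map_add, ← map_zero D.q] at h
  have := D.q_inj h
  ext i
  have := DFunLike.congr_fun this i
  simp at this
  simp [this.1]

/-- simple reflection -/
noncomputable def s (i : ι) : E →ₗ[ℂ] E :=
  LinearMap.id - (D.co i).smulRight (D.α i)

omit [DecidableEq ι] in
lemma s_apply (i : ι) (x : E) : D.s i x = x - D.co i x • D.α i := rfl

omit [DecidableEq ι] in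
lemma co_self (i : ι) : D.co i (D.α i) = 2 := by rw [D.co_α, D.A_self]; norm_num

omit [DecidableEq ι] in
lemma s_s (i : ι) (x : E) : D.s i (D.s i x) = x := by
  simp only [s_apply, map_sub, map_smul, D.co_self, smul_eq_mul, sub_smul]
  module

omit [DecidableEq ι] in
lemma s_α (i : ι) : D.s i (D.α i) = - D.α i := by
  rw [s_apply, co_self]; module

omit [DecidableEq ι] in
lemma B_s (i : ι) (x : E) : D.B (D.s i x) (D.s i x) = D.B x x := by
  simp only [s_apply, map_sub, map_smul, LinearMap.sub_apply, LinearMap.smul_apply, smul_eq_mul]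
  rw [D.Bsymm (D.α i) x, D.B_α, D.B_α, D.co_self]
  ring

/-- adjacency -/
def adj (i j : ι) : Prop := i ≠ j ∧ D.A i j ≠ 0

omit [DecidableEq ι] in
lemma A_symm (i j : ι) : D.A i j * D.d i = D.A j i * D.d j := by
  have h1 := D.B_α i (D.α j)
  have h2 := D.B_α j (D.α i)
  rw [D.Bsymm, h2, D.co_α, D.co_α] at h1
  exact_mod_cast h1.symm

omit [DecidableEq ι] in
lemma adj_symm (i j : ι) (h : D.adj i j) : D.adj j i := by
  refine ⟨h.1.symm, fun h0 => h.2 ?_⟩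
  have := D.A_symm i j
  rw [h0, Int.cast_zero, zero_mul, mul_eq_zero] at this
  rcases this with h | h
  · exact_mod_cast h
  · exact absurd h (D.d_pos i).ne'

/-- W-antisymmetric coefficient functions with highest term `Λ` -/
structure Anti (u : E → ℂ) (Λ : E) (a : ι → ℕ) : Prop where
  sup : ∀ ν, u ν ≠ 0 → ∃ c, ν = Λ - D.q c
  anti : ∀ i ν, u (D.s i ν) = - u ν
  coΛ : ∀ i, D.co i Λ = a i
  apos : ∀ i, 0 < a i

variable {D} {u : E → ℂ} {Λ : E} {a : ι → ℕ}

variable (D) (a) in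
/-- the pairing of `Λ - β` with the `i`-th coroot -/
def m (i : ι) (β : ι →₀ ℕ) : ℤ := a i - ∑ j, D.A i j * (β j : ℤ)

namespace Anti

omit [DecidableEq ι] in
lemma co_eq (h : D.Anti u Λ a) (i : ι) (β : ι →₀ ℕ) :
    D.co i (Λ - D.q β) = D.m a i β := by
  rw [map_sub, h.coΛ, q_apply, map_sum, m]
  push_cast
  congr 1
  refine Finset.sum_congr rfl fun j _ => ?_
  rw [map_smul, D.co_α, smul_eq_mul, mul_comm]

omit [DecidableEq ι] in
lemma norm_eq (h : D.Anti u Λ a) (β : ι →₀ ℕ) :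
    D.B Λ Λ - D.B (Λ - D.q β) (Λ - D.q β) =
      ((∑ i, (β i : ℝ) * D.d i * ((a i : ℝ) + D.m a i β) : ℝ) : ℂ) := by
  have key : ∀ x, D.B x (D.q β) = ∑ i, (β i : ℂ) * (D.co i x * D.d i) := fun x => by
    rw [q_apply, map_sum]
    refine Finset.sum_congr rfl fun j _ => ?_
    rw [map_smul, D.B_α, smul_eq_mul]
  have e : D.B Λ Λ - D.B (Λ - D.q β) (Λ - D.q β) =
      D.B Λ (D.q β) + D.B (Λ - D.q β) (D.q β) := by
    simp only [map_sub, LinearMap.sub_apply]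
    rw [D.Bsymm (D.q β) Λ]; ring
  rw [e, key, key, ← Finset.sum_add_distrib]
  push_cast
  refine Finset.sum_congr rfl fun j _ => ?_
  rw [h.co_eq, h.coΛ]; ring

lemma refl (h : D.Anti u Λ a) (i : ι) {β : ι →₀ ℕ} (hu : u (Λ - D.q β) ≠ 0) :
    ∃ β' : ι →₀ ℕ, D.s i (Λ - D.q β) = Λ - D.q β' ∧ u (Λ - D.q β') ≠ 0 ∧ (∀ j, j ≠ i → β' j = β j) ∧
      (β' i : ℤ) = β i + D.m a i β := by
  have h1 := h.anti i (Λ - D.q β)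
  have h2 : u (D.s i (Λ - D.q β)) ≠ 0 := by rw [h1]; exact neg_ne_zero.2 hu
  obtain ⟨c, hc⟩ := h.sup _ h2
  refine ⟨c, hc, hc ▸ h2, ?_⟩
  rw [s_apply, h.co_eq, sub_sub, sub_right_inj, q_apply, q_apply] at hc
  have h3 : ∑ j, ((β j : ℂ) + (if j = i then (D.m a i β : ℂ) else 0) - c j) • D.α j = 0 := by
    simp only [sub_smul, add_smul, Finset.sum_sub_distrib, Finset.sum_add_distrib, ite_smul,
      zero_smul, Finset.sum_ite_eq', Finset.mem_univ, if_true]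
    rw [hc, sub_self]
  have h4 := Fintype.linearIndependent_iff.1 D.li _ h3
  constructor
  · intro j hj
    have := h4 j
    rw [if_neg hj, add_zero, sub_eq_zero] at this
    exact_mod_cast this.symm
  · have := h4 i
    rw [if_pos rfl, sub_eq_zero] at this
    exact_mod_cast this.symm

lemma sum_lt {i : ι} {β β' : ι →₀ ℕ} (h1 : ∀ j, j ≠ i → β' j = β j) (h2 : β' i < β i) :
    ∑ j, β' j < ∑ j, β j := by
  refine Finset.sum_lt_sum (fun j _ => ?_) ⟨i, Finset.mem_univ _, h2⟩
  by_cases hj : j = i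
  · subst hj; exact h2.le
  · exact (h1 j hj).le

/-- a weight in the support has the same norm as the top one, when `a = 1`. -/
lemma norm_of_one (h : D.Anti u Λ 1) (n : ℕ) : ∀ (β : ι →₀ ℕ), ∑ j, β j = n → u (Λ - D.q β) ≠ 0 →
    D.B (Λ - D.q β) (Λ - D.q β) = D.B Λ Λ := by
  induction n using Nat.strong_induction_on with
  | _ n ih =>
  intro β hn hu
  by_cases hm : ∀ i, 0 ≤ D.m 1 i β
  · have hm' : ∀ i, 1 ≤ D.m 1 i β := by
      intro i
      rcases (hm i).lt_or_eq with h0 | h0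
      · exact h0
      · exfalso
        have h1 := h.anti i (Λ - D.q β)
        rw [s_apply, h.co_eq, ← h0, Int.cast_zero, zero_smul, sub_zero] at h1
        exact hu (self_eq_neg.1 h1)
    have : β = 0 := D.definite β fun i => by
      have := hm' i
      simp only [m, Pi.one_apply] at this
      omega
    subst this
    simp
  · push Not at hm
    obtain ⟨i, hi⟩ := hm
    obtain ⟨β', e, hu', h1, h2⟩ := h.refl i hu
    have := ih _ (hn ▸ sum_lt h1 (by omega)) β' rfl hu'
    rw [← this, ← e, D.B_s]

lemma adm (h : D.Anti u Λ a) (hB : ∀ ν, u ν ≠ 0 → D.B ν ν = D.B Λ Λ) (n : ℕ) :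
    ∀ (β : ι →₀ ℕ), ∑ j, β j = n → u (Λ - D.q β) ≠ 0 → ∀ i, β i = 0 ∨ a i ≤ β i := by
  induction n using Nat.strong_induction_on with
  | _ n ih =>
  intro β hn hu
  by_cases hm : ∀ i, 0 ≤ D.m a i β
  · intro i
    left
    have h1 := h.norm_eq β
    rw [hB _ hu, sub_self] at h1
    have h2 : (∑ i, (β i : ℝ) * D.d i * ((a i : ℝ) + D.m a i β) : ℝ) = 0 := by
      exact_mod_cast h1.symm
    rw [Finset.sum_eq_zero_iff_of_nonneg] at h2
    · have h3 := h2 i (Finset.mem_univ _)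
      have := D.d_pos i
      have h4 : (0:ℝ) < a i := by exact_mod_cast h.apos i
      have h5 : (0:ℝ) ≤ D.m a i β := by exact_mod_cast hm i
      rcases mul_eq_zero.1 h3 with h3 | h3
      · rcases mul_eq_zero.1 h3 with h3 | h3
        · exact_mod_cast h3
        · linarith
      · linarith
    · intro i _
      have := D.d_pos i
      have h5 : (0:ℝ) ≤ D.m a i β := by exact_mod_cast hm i
      positivity
  · push Not at hm
    obtain ⟨j, hj⟩ := hm
    obtain ⟨β', e, hu', h1, h2⟩ := h.refl j hu
    have key := ih _ (hn ▸ sum_lt h1 (by omega)) β' rfl hu'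
    intro i
    by_cases hij : i = j
    · subst hij
      rcases key i with h3 | h3
      · right
        rw [m, ← Finset.add_sum_erase _ _ (Finset.mem_univ i), D.A_self] at h2
        have : ∑ x ∈ Finset.univ.erase i, D.A i x * (β x : ℤ) ≤ 0 :=
          Finset.sum_nonpos fun x hx => mul_nonpos_of_nonpos_of_nonneg
            (D.A_nonpos _ _ (Finset.ne_of_mem_erase hx).symm) (by positivity)
        omega
      · right; omega
    · rw [← h1 i hij]; exact key i

open Comb in
lemma m_ex (I : Finset ι) (i : ι) : D.m a i (ex a I) = a i - ∑ j ∈ I, D.A i j * (a j : ℤ) := by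
  rw [m]
  congr 1
  simp [apply_ite, Finset.sum_ite_mem]

open Comb in
lemma coeff_ex (h : D.Anti u Λ a) (hB : ∀ ν, u ν ≠ 0 → D.B ν ν = D.B Λ Λ) (h1 : u Λ = 1)
    (I : Finset ι) : u (Λ - D.q (ex a I)) = sgn D.adj I := by
  classical
  by_cases hI : ∀ i ∈ I, ∀ j ∈ I, ¬ D.adj i j
  · rw [sgn, if_pos hI]
    induction I using Finset.induction_on with
    | empty => simp [h1]
    | insert j I hj ih =>
      rw [Finset.card_insert_of_notMem hj, pow_succ, mul_neg_one, ← ih fun i hi k hk =>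
        hI i (Finset.mem_insert_of_mem hi) k (Finset.mem_insert_of_mem hk), ← h.anti j]
      congr 1
      have hm : D.m a j (ex a I) = a j := by
        rw [m_ex, Finset.sum_eq_zero, sub_zero]
        intro k hk
        have := hI j (Finset.mem_insert_self _ _) k (Finset.mem_insert_of_mem hk)
        rw [adj, not_and_not_right] at this
        rw [this (fun e => hj (e ▸ hk)), zero_mul]
      rw [s_apply, h.co_eq, hm, sub_sub]
      congr 1
      have : D.q (ex a {j}) = (a j : ℂ) • D.α j := by
        rw [q_apply]
        simp [apply_ite]
      rw [Finset.insert_eq, Finset.union_comm, ← ex_add a (by simpa using hj), map_add, this]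
      simp
  · rw [sgn, if_neg hI]
    by_contra hu
    have h1 := h.norm_eq (ex a I)
    rw [hB _ hu, sub_self] at h1
    have h2 : (∑ i, (ex a I i : ℝ) * D.d i * ((a i : ℝ) + D.m a i (ex a I)) : ℝ) = 0 := by
      exact_mod_cast h1.symm
    have h3 : ∀ i ∈ I, (a i : ℤ) + D.m a i (ex a I) = ∑ j ∈ I.erase i, - (D.A i j * (a j : ℤ)) := by
      intro i hi
      rw [m_ex, ← Finset.add_sum_erase _ _ hi, D.A_self, Finset.sum_neg_distrib]
      ring
    have h4 : ∀ i, ∀ j ∈ I.erase i, 0 ≤ - (D.A i j * (a j : ℤ)) := fun i j hj => by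
      have := mul_nonpos_of_nonpos_of_nonneg (D.A_nonpos _ _ (Finset.ne_of_mem_erase hj).symm)
        (show 0 ≤ (a j : ℤ) by positivity)
      omega
    push Not at hI
    obtain ⟨i, hi, j, hj, hij⟩ := hI
    rw [Finset.sum_eq_zero_iff_of_nonneg] at h2
    · have h5 := h2 i (Finset.mem_univ _)
      have h6 : 0 < (a i : ℤ) + D.m a i (ex a I) := by
        rw [h3 i hi]
        refine Finset.sum_pos' (h4 i) ⟨j, Finset.mem_erase.2 ⟨hij.1.symm, hj⟩, ?_⟩
        have := (D.A_nonpos _ _ hij.1).lt_of_ne hij.2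
        have := mul_neg_of_neg_of_pos this (show 0 < (a j : ℤ) by exact_mod_cast h.apos j)
        omega
      have h7 : (0:ℝ) < (a i : ℝ) + D.m a i (ex a I) := by exact_mod_cast h6
      have h8 : (0:ℝ) < ex a I i := by simp [hi, h.apos i]
      have := D.d_pos i
      exact absurd h5 (by positivity)
    · intro k _
      by_cases hk : k ∈ I
      · have h6 : 0 ≤ (a k : ℤ) + D.m a k (ex a I) := by
          rw [h3 k hk]; exact Finset.sum_nonneg (h4 k)
        have h7 : (0:ℝ) ≤ (a k : ℝ) + D.m a k (ex a I) := by exact_mod_cast h6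
        have := D.d_pos k
        positivity
      · simp [hk]

theorem good (h : D.Anti u Λ a) (hB : ∀ ν, u ν ≠ 0 → D.B ν ν = D.B Λ Λ) (h1 : u Λ = 1) :
    Comb.Good D.adj a (fun β => u (Λ - D.q β)) where
  pos := h.apos
  adm β hβ := h.adm hB _ β rfl hβ
  coeff_ex I := h.coeff_ex hB h1 I

end Anti
end RD
end UF

namespace UF

/-- group algebra -/
abbrev GA (E : Type*) [AddCommGroup E] := AddMonoidAlgebra ℂ E

section GAdef
variable {E : Type*} [AddCommGroup E]

/-- formal exponential -/
noncomputable def ee (μ : E) : GA E := AddMonoidAlgebra.single μ 1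

lemma ee_add (μ ν : E) : ee (μ + ν) = ee μ * ee ν := by
  simp [ee]

lemma ee_zero : ee (0 : E) = 1 := rfl

lemma ee_mul_cancel (μ : E) (f g : GA E) (h : ee μ * f = ee μ * g) : f = g := by
  have : ee (-μ) * (ee μ * f) = ee (-μ) * (ee μ * g) := by rw [h]
  rwa [← mul_assoc, ← mul_assoc, ← ee_add, neg_add_cancel, ee_zero, one_mul, one_mul] at this

lemma coeff_ee_mul (μ ν : E) (f : GA E) : (ee μ * f).coeff (μ + ν) = f.coeff ν := by
  rw [ee, AddMonoidAlgebra.coeff_single_mul_eq_mul_coeff ν, one_mul]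
  intro m' _
  exact add_right_inj μ

/-- multiplication of coefficients by a function -/
noncomputable def mulc (φ : E → ℂ) : GA E →ₗ[ℂ] GA E where
  toFun f := .ofCoeff (Finsupp.onFinset f.coeff.support (fun μ => φ μ * f.coeff μ)
    (fun μ h => Finsupp.mem_support_iff.2 (right_ne_zero_of_mul h)))
  map_add' f g := by ext; simp [mul_add]
  map_smul' c f := by ext; simp; ring

lemma coeff_mulc (φ : E → ℂ) (f : GA E) (μ : E) : (mulc φ f).coeff μ = φ μ * f.coeff μ := rfl

lemma mulc_ee (φ : E → ℂ) (μ : E) : mulc φ (ee μ) = φ μ • ee μ := by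
  classical
  ext ν
  rw [coeff_mulc]
  simp only [ee, AddMonoidAlgebra.coeff_smul, Finsupp.smul_apply, AddMonoidAlgebra.coeff_single,
    Finsupp.single_apply, smul_eq_mul]
  split_ifs with h
  · rw [h]
  · simp

lemma GA_ind {p : GA E → Prop} (f : GA E) (h0 : p 0) (hadd : ∀ f g, p f → p g → p (f + g))
    (hs : ∀ (c : ℂ) μ, p (c • ee μ)) : p f := by
  induction f using AddMonoidAlgebra.induction_linear with
  | zero => exact h0
  | add f g hf hg => exact hadd f g hf hg
  | single μ r =>
    have := hs r μ
    rwa [ee, AddMonoidAlgebra.smul_single, smul_eq_mul, mul_one] at this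

lemma mulc_mul_of_add (φ : E → ℂ) (hφ : ∀ x y, φ (x + y) = φ x + φ y) (f g : GA E) :
    mulc φ (f * g) = mulc φ f * g + f * mulc φ g := by
  induction f using GA_ind with
  | h0 => simp
  | hadd f f' hf hf' => rw [add_mul, map_add, hf, hf', map_add]; ring
  | hs c μ =>
    induction g using GA_ind with
    | h0 => simp
    | hadd g g' hg hg' => rw [mul_add, map_add, hg, hg', map_add]; ring
    | hs c' ν =>
      simp only [smul_mul_assoc, mul_smul_comm, map_smul, mulc_ee, ← ee_add, hφ]
      module

end GAdef

namespace RD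

variable {E ι : Type*} [AddCommGroup E] [Module ℂ E] [Fintype ι] (D : RD E ι)

/-- directional derivative -/
noncomputable def pd (t : E) : GA E →ₗ[ℂ] GA E := mulc fun μ => D.B t μ

/-- Laplacian -/
noncomputable def lap : GA E →ₗ[ℂ] GA E := mulc fun μ => D.B μ μ

lemma pd_mul (t : E) (f g : GA E) : D.pd t (f * g) = D.pd t f * g + f * D.pd t g :=
  mulc_mul_of_add _ (fun x y => map_add _ _ _) f g

lemma lap_ee_mul (η : E) (f : GA E) :
    D.lap (ee η * f) = ee η * (D.lap f + (2 : ℂ) • D.pd η f + D.B η η • f) := by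
  induction f using GA_ind with
  | h0 => simp
  | hadd f g hf hg => rw [mul_add, map_add, hf, hg, map_add, map_add, ← mul_add]; congr 1; module
  | hs c μ =>
    rw [mul_smul_comm, ← ee_add]
    simp only [lap, pd, map_smul, mulc_ee, map_add, LinearMap.add_apply, D.Bsymm μ η, mul_add,
      mul_smul_comm, ← ee_add]
    module

/-- Weyl denominator factor -/
noncomputable def fm (x : E) : GA E := ee ((2⁻¹ : ℂ) • x) - ee (-((2⁻¹ : ℂ) • x))
/-- the symmetric companion -/
noncomputable def fp (x : E) : GA E := ee ((2⁻¹ : ℂ) • x) + ee (-((2⁻¹ : ℂ) • x))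

lemma pd_smul (c : ℂ) (x : E) (f : GA E) : D.pd (c • x) f = c • D.pd x f := by
  ext μ
  simp [pd, coeff_mulc, mul_assoc]

lemma pd_neg (x : E) (f : GA E) : D.pd (- x) f = - D.pd x f := by
  have := D.pd_smul (-1) x f
  simpa using this

lemma lap_fm_mul (x : E) (f : GA E) :
    D.lap (fm x * f) = fm x * D.lap f + fp x * D.pd x f +
      D.B ((2⁻¹ : ℂ) • x) ((2⁻¹ : ℂ) • x) • (fm x * f) := by
  rw [fm, fp, sub_mul, map_sub, lap_ee_mul, lap_ee_mul, pd_neg, pd_smul]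
  simp only [map_neg, LinearMap.neg_apply, neg_neg, mul_add, sub_mul, add_mul, smul_sub,
    mul_smul_comm, mul_neg, smul_neg, smul_smul]
  module

lemma lap_prod_mul [DecidableEq E] (S : Finset E) (g : GA E) :
    D.lap ((∏ x ∈ S, fm x) * g) = D.lap (∏ x ∈ S, fm x) * g + (∏ x ∈ S, fm x) * D.lap g +
      ∑ x ∈ S, (∏ y ∈ S.erase x, fm y) * (fp x * D.pd x g) := by
  induction S using Finset.induction_on with
  | empty =>
    have : D.lap 1 = 0 := by rw [lap, ← ee_zero, mulc_ee]; simp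
    simp [this]
  | insert x S hx ih =>
    rw [Finset.prod_insert hx, Finset.sum_insert hx, Finset.erase_insert hx, mul_assoc, lap_fm_mul,
      lap_fm_mul, ih, pd_mul]
    have : ∑ y ∈ S, (∏ z ∈ (insert x S).erase y, fm z) * (fp y * D.pd y g) =
        fm x * ∑ y ∈ S, (∏ z ∈ S.erase y, fm z) * (fp y * D.pd y g) := by
      rw [Finset.mul_sum]
      refine Finset.sum_congr rfl fun y hy => ?_
      rw [Finset.erase_insert_of_ne (fun e : x = y => hx (e ▸ hy)), Finset.prod_insert (by simp [hx]),
        mul_assoc]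
    rw [this]
    simp only [add_mul, mul_add, smul_mul_assoc, mul_assoc]
    ring

/-- exponents in the negative cone -/
noncomputable def Φ : MvPolynomial ι ℂ →+* GA E :=
  AddMonoidAlgebra.mapDomainRingHom ℂ (-D.q)

lemma Φ_apply (p : MvPolynomial ι ℂ) : D.Φ p = AddMonoidAlgebra.mapDomain (-D.q) p := rfl

lemma Φ_inj : Function.Injective D.Φ :=
  AddMonoidAlgebra.mapDomain_injective fun x y h => D.q_inj (neg_injective h)

lemma Φ_monomial (β : ι →₀ ℕ) : D.Φ (MvPolynomial.monomial β 1) = ee (-D.q β) := by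
  rw [Φ_apply]
  exact AddMonoidAlgebra.mapDomain_single

lemma coeff_Φ (p : MvPolynomial ι ℂ) (β : ι →₀ ℕ) :
    (D.Φ p).coeff (-D.q β) = MvPolynomial.coeff β p := by
  rw [Φ_apply, AddMonoidAlgebra.mapDomain]
  exact Finsupp.mapDomain_apply (fun x y h => D.q_inj (neg_injective h)) _ _

lemma coeff_Φ_ne (p : MvPolynomial ι ℂ) (ν : E) (h : (D.Φ p).coeff ν ≠ 0) :
    ∃ β, ν = - D.q β := by
  by_contra hc
  apply h
  rw [Φ_apply, AddMonoidAlgebra.mapDomain]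
  refine Finsupp.mapDomain_of_notMem_range _ _ ?_
  rintro ⟨β, hβ⟩
  exact hc ⟨β, hβ.symm⟩

/-- `f` has top exponent `Λ` and normalized polynomial `p`. -/
structure Top (f : GA E) (Λ : E) (p : MvPolynomial ι ℂ) : Prop where
  eq : f = ee Λ * D.Φ p
  const : MvPolynomial.coeff 0 p = 1

variable {D}

lemma Top.mul {f g : GA E} {Λ M : E} {p q : MvPolynomial ι ℂ} (hf : D.Top f Λ p)
    (hg : D.Top g M q) : D.Top (f * g) (Λ + M) (p * q) where
  eq := by rw [hf.eq, hg.eq, ee_add, map_mul]; ring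
  const := by
    have h1 := hf.const
    have h2 := hg.const
    rw [← MvPolynomial.constantCoeff_eq] at *
    rw [map_mul, h1, h2, mul_one]

lemma Top.one : D.Top 1 0 1 := ⟨by simp [ee_zero], by simp⟩

lemma Top.prod {κ : Type*} (S : Finset κ) {f : κ → GA E} {Λ : κ → E} {p : κ → MvPolynomial ι ℂ}
    (h : ∀ k ∈ S, D.Top (f k) (Λ k) (p k)) :
    D.Top (∏ k ∈ S, f k) (∑ k ∈ S, Λ k) (∏ k ∈ S, p k) := by
  classical
  induction S using Finset.induction_on with
  | empty => simpa using Top.one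
  | insert x S hx ih =>
    rw [Finset.prod_insert hx, Finset.sum_insert hx, Finset.prod_insert hx]
    exact (h x (Finset.mem_insert_self _ _)).mul
      (ih fun k hk => h k (Finset.mem_insert_of_mem hk))

lemma Top.coeff {f : GA E} {Λ : E} {p : MvPolynomial ι ℂ} (h : D.Top f Λ p) (β : ι →₀ ℕ) :
    f.coeff (Λ - D.q β) = MvPolynomial.coeff β p := by
  rw [h.eq, sub_eq_add_neg, coeff_ee_mul, coeff_Φ]

lemma Top.coeff_top {f : GA E} {Λ : E} {p : MvPolynomial ι ℂ} (h : D.Top f Λ p) :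
    f.coeff Λ = 1 := by
  have := h.coeff 0
  rwa [map_zero, sub_zero, h.const] at this

lemma Top.sup {f : GA E} {Λ : E} {p : MvPolynomial ι ℂ} (h : D.Top f Λ p) (ν : E)
    (hν : f.coeff ν ≠ 0) : ∃ c, ν = Λ - D.q c := by
  rw [h.eq, ← add_sub_cancel Λ ν, coeff_ee_mul] at hν
  obtain ⟨β, hβ⟩ := D.coeff_Φ_ne p _ hν
  exact ⟨β, by rw [sub_eq_iff_eq_add.1 hβ]; abel⟩

lemma Top.unique {f : GA E} {Λ M : E} {p q : MvPolynomial ι ℂ} (h : D.Top f Λ p)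
    (h' : D.Top f M q) : Λ = M ∧ p = q := by
  obtain ⟨c, hc⟩ := h'.sup Λ (by rw [h.coeff_top]; exact one_ne_zero)
  obtain ⟨c', hc'⟩ := h.sup M (by rw [h'.coeff_top]; exact one_ne_zero)
  have h0 : D.q c + D.q c' = 0 := by
    rw [hc] at hc'
    have : M - (M - D.q c - D.q c') = 0 := by rw [← hc', sub_self]
    rw [← this]; abel
  have hc0 := D.eq_zero_of_q_add h0
  have : Λ = M := by rw [hc, hc0, map_zero, sub_zero]
  subst this
  refine ⟨rfl, D.Φ_inj (ee_mul_cancel Λ _ _ ?_)⟩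
  rw [← h.eq, ← h'.eq]

variable (D)

/-- half sum of positive roots -/
noncomputable def rho : E := ∑ x ∈ D.pos, (2⁻¹ : ℂ) • x

/-- Weyl denominator -/
noncomputable def R : GA E := ∏ x ∈ D.pos, fm x

lemma Top_fm (x : E) (hx : x ∈ D.pos) : ∃ p, D.Top (fm x) ((2⁻¹ : ℂ) • x) p := by
  obtain ⟨c, hc, hx⟩ := D.pos_mem x hx
  refine ⟨1 - MvPolynomial.monomial c 1, ?_, ?_⟩
  · rw [map_sub, map_one, Φ_monomial, mul_sub, mul_one, ← ee_add, fm]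
    congr 2
    rw [q_apply, ← hx]
    module
  · classical
    rw [MvPolynomial.coeff_sub, MvPolynomial.coeff_monomial, if_neg hc]
    simp

lemma Top_R : ∃ p, D.Top D.R D.rho p := by
  choose! p hp using D.Top_fm
  exact ⟨_, Top.prod D.pos hp⟩

/-- reflection on group algebra -/
noncomputable def sg (i : ι) : GA E →+* GA E :=
  AddMonoidAlgebra.mapDomainRingHom ℂ (D.s i).toAddMonoidHom

lemma sg_ee (i : ι) (μ : E) : D.sg i (ee μ) = ee (D.s i μ) := by
  exact AddMonoidAlgebra.mapDomain_single

lemma s_inj (i : ι) : Function.Injective (D.s i) :=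
  Function.LeftInverse.injective (D.s_s i)

lemma coeff_sg (i : ι) (f : GA E) (μ : E) : (D.sg i f).coeff (D.s i μ) = f.coeff μ :=
  Finsupp.mapDomain_apply (D.s_inj i) _ _

lemma sg_fm (i : ι) (x : E) : D.sg i (fm x) = fm (D.s i x) := by
  rw [fm, fm, map_sub, sg_ee, sg_ee, map_neg, map_smul]

lemma fm_neg (x : E) : fm (-x) = - fm x := by
  rw [fm, fm, smul_neg, neg_neg, neg_sub]

lemma α_ne (i : ι) : D.α i ≠ 0 := D.li.ne_zero i

lemma bij [DecidableEq E] (i : ι) {M : Type*} [CommMonoid M] (F : E → M) :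
    ∏ x ∈ D.pos.erase (D.α i), F (D.s i x) = ∏ x ∈ D.pos.erase (D.α i), F x := by
  have hmem : ∀ x ∈ D.pos.erase (D.α i), D.s i x ∈ D.pos.erase (D.α i) := by
    intro x hx
    obtain ⟨h1, h2⟩ := Finset.mem_erase.1 hx
    refine Finset.mem_erase.2 ⟨fun h => ?_, D.perm i x h2 h1⟩
    have : x = - D.α i := by rw [← D.s_s i x, h, D.s_α]
    obtain ⟨c, hc, hcx⟩ := D.pos_mem x h2
    obtain ⟨c', hc', hcx'⟩ := D.pos_mem _ (D.simple_mem i)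
    refine hc (D.eq_zero_of_q_add (y := c') ?_)
    rw [q_apply, q_apply, ← hcx, ← hcx', this, neg_add_cancel]
  exact Finset.prod_nbij' (D.s i) (D.s i) hmem hmem (fun x _ => D.s_s i x) (fun x _ => D.s_s i x)
    (fun _ _ => rfl)

lemma bij_add [DecidableEq E] (i : ι) {M : Type*} [AddCommMonoid M] (F : E → M) :
    ∑ x ∈ D.pos.erase (D.α i), F (D.s i x) = ∑ x ∈ D.pos.erase (D.α i), F x :=
  D.bij i (M := Multiplicative M) F

lemma sg_R (i : ι) : D.sg i D.R = - D.R := by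
  classical
  rw [R, map_prod, ← Finset.mul_prod_erase _ _ (D.simple_mem i),
    ← Finset.mul_prod_erase _ _ (D.simple_mem i), sg_fm, s_α, fm_neg, neg_mul]
  simp only [sg_fm]
  rw [D.bij i fm]

lemma co_rho (i : ι) : D.co i D.rho = 1 := by
  classical
  have h : D.s i D.rho = D.rho - D.α i := by
    rw [rho, map_sum, ← Finset.add_sum_erase _ _ (D.simple_mem i),
      ← Finset.add_sum_erase _ _ (D.simple_mem i)]
    simp only [map_smul]
    rw [D.bij_add i (fun x => (2⁻¹ : ℂ) • x), s_α]
    module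
  rw [s_apply, sub_right_inj] at h
  have : (D.co i D.rho - 1) • D.α i = 0 := by rw [sub_smul, h, one_smul, sub_self]
  rcases smul_eq_zero.1 this with h | h
  · exact sub_eq_zero.1 h
  · exact absurd h (D.α_ne i)

lemma anti_of_sg (i : ι) (f : GA E) (h : D.sg i f = - f) (ν : E) :
    f.coeff (D.s i ν) = - f.coeff ν := by
  rw [← D.coeff_sg i f ν, h]
  simp

lemma lap_R [DecidableEq ι] : D.lap D.R = D.B D.rho D.rho • D.R := by
  obtain ⟨p, hp⟩ := D.Top_R
  have hA : D.Anti D.R.coeff D.rho 1 :=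
    ⟨hp.sup, fun i ν => D.anti_of_sg i _ (D.sg_R i) ν, fun i => by simp [co_rho], fun _ => one_pos⟩
  ext ν
  rw [lap, coeff_mulc, AddMonoidAlgebra.coeff_smul, Finsupp.smul_apply, smul_eq_mul]
  by_cases h : D.R.coeff ν = 0
  · rw [h, mul_zero, mul_zero]
  · obtain ⟨β, rfl⟩ := hp.sup ν h
    rw [hA.norm_of_one _ β rfl h]

/-- characters of irreducible modules, abstractly -/
structure IsChar (ch : GA E) (l : ι → ℕ) : Prop where
  top : ∃ lam p, D.Top ch lam p ∧ ∀ i, D.co i lam = l i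
  inv : ∀ i, D.sg i ch = ch
  freud : ∃ (c : ℂ) (G : E → GA E), c • ch = D.lap ch + ∑ x ∈ D.pos, G x ∧
    ∀ x ∈ D.pos, fm x * G x = fp x * D.pd x ch

variable {D} in
lemma IsChar.good [DecidableEq ι] {ch : GA E} {l : ι → ℕ} (h : D.IsChar ch l) :
    ∃ Λ P, D.Top (D.R * ch) Λ P ∧ Comb.Good D.adj (fun i => l i + 1) (P : MvPowerSeries ι ℂ) := by
  classical
  obtain ⟨lam, p, hp, hl⟩ := h.top
  obtain ⟨pR, hR⟩ := D.Top_R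
  obtain ⟨c, G, hG1, hG2⟩ := h.freud
  have hT := hR.mul hp
  refine ⟨_, _, hT, ?_⟩
  have hA : D.Anti (D.R * ch).coeff (D.rho + lam) (fun i => l i + 1) := by
    refine ⟨hT.sup, fun i ν => D.anti_of_sg i _ ?_ ν, fun i => ?_, fun _ => Nat.succ_pos _⟩
    · rw [map_mul, sg_R, h.inv, neg_mul]
    · rw [map_add, co_rho, hl]; push_cast; ring
  have hlap : D.lap (D.R * ch) = (D.B D.rho D.rho + c) • (D.R * ch) := by
    rw [R, lap_prod_mul, ← R, lap_R, add_smul, ← mul_smul_comm, ← mul_smul_comm c, hG1, mul_add,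
      Finset.mul_sum, smul_mul_assoc, mul_smul_comm, add_assoc]
    congr 2
    refine Finset.sum_congr rfl fun x hx => ?_
    rw [← hG2 x hx, R, ← Finset.mul_prod_erase _ _ hx]
    ring
  have hB : ∀ ν, (D.R * ch).coeff ν ≠ 0 → D.B ν ν = D.B D.rho D.rho + c := by
    intro ν hν
    have := congrArg (fun f : GA E => f.coeff ν) hlap
    simp only [lap, coeff_mulc, AddMonoidAlgebra.coeff_smul, Finsupp.smul_apply,
      smul_eq_mul] at this
    exact mul_right_cancel₀ hν this
  have h1 := hT.coeff_top
  have hB' := hB _ (by rw [h1]; exact one_ne_zero)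
  have hg := hA.good (fun ν hν => by rw [hB ν hν, hB']) h1
  refine Eq.mpr (congrArg _ ?_) hg
  ext β
  rw [MvPolynomial.coeff_coe, ← hT.coeff β]
  rfl

theorem unique_of_char [DecidableEq ι] (v : ι)
    (hc : Comb.Conn D.adj (Finset.univ.erase v) (Comb.nbr D.adj v)) {n : ℕ}
    (ch ch' : Fin n → GA E) (l l' : Fin n → ι → ℕ)
    (h : ∀ j, D.IsChar (ch j) (l j)) (h' : ∀ j, D.IsChar (ch' j) (l' j))
    (h1 : ∀ j k, l j = l k → ch j = ch k) (h2 : ∀ j k, l' j = l' k → ch' j = ch' k)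
    (h3 : ∀ j k, l j = l' k → ch j = ch' k) (hprod : ∏ j, ch j = ∏ j, ch' j) :
    ∃ σ : Equiv.Perm (Fin n), ∀ i, l i = l' (σ i) := by
  choose Λ P hP gP using fun j => (h j).good
  choose M Q hQ gQ using fun j => (h' j).good
  have conv : ∀ {x y : ι → ℕ}, (fun i => x i + 1) = (fun i => y i + 1) → x = y := fun e => by
    ext i; simpa using congrFun e i
  have e1 := Top.prod Finset.univ fun j _ => hP j
  have e2 := Top.prod Finset.univ fun j _ => hQ j
  rw [Finset.prod_mul_distrib, hprod, ← Finset.prod_mul_distrib] at e1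
  have hPQ := (e1.unique e2).2
  obtain ⟨σ, hσ⟩ := Comb.comb D.adj_symm (fun i hi => hi.1 rfl) v hc _ _ _ _ gP gQ
    (fun j k e => by
      have := h1 j k (conv e)
      have h4 := hP j
      rw [this] at h4
      rw [(h4.unique (hP k)).2])
    (fun j k e => by
      have := h2 j k (conv e)
      have h4 := hQ j
      rw [this] at h4
      rw [(h4.unique (hQ k)).2])
    (fun j k e => by
      have := h3 j k (conv e)
      have h4 := hP j
      rw [this] at h4
      rw [(h4.unique (hQ k)).2])
    (by
      have := congrArg (MvPolynomial.coeToMvPowerSeries.ringHom (σ := ι) (R := ℂ)) hPQ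
      rw [map_prod, map_prod] at this; exact this)
  exact ⟨σ, fun i => conv (hσ i)⟩

end RD
end UF

namespace UF
open LieAlgebra LieAlgebra.IsKilling LieModule Module

section
variable {L : Type*} [LieRing L] [LieAlgebra ℂ L] [FiniteDimensional ℂ L] [IsKilling ℂ L]
  (H : LieSubalgebra ℂ L) [H.IsCartanSubalgebra]

/-- the element of the Cartan subalgebra dual to a weight -/
noncomputable def tt (μ : Dual ℂ H) : H := (cartanEquivDual H).symm μ

lemma apply_tt (μ ν : Dual ℂ H) : μ (tt H ν) = traceForm ℂ H L (tt H μ) (tt H ν) := by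
  have : cartanEquivDual H (tt H μ) (tt H ν) = μ (tt H ν) := by
    rw [tt, LinearEquiv.apply_symm_apply]
  rw [← this]; rfl

lemma apply_tt_symm (μ ν : Dual ℂ H) : μ (tt H ν) = ν (tt H μ) := by
  rw [apply_tt H μ ν, apply_tt H ν μ, traceForm_comm]

lemma killing_tt (μ : Dual ℂ H) (h : H) : killingForm ℂ L (tt H μ : L) (h : L) = μ h := by
  have : cartanEquivDual H (tt H μ) h = μ h := by
    rw [tt, LinearEquiv.apply_symm_apply]
  rw [← this]; rfl

lemma trace_sum (x y : H) : traceForm ℂ H L x y = ∑ γ : H.root, γ.1 x * γ.1 y := by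
  have := LinearMap.congr_fun₂ (restrict_killingForm_eq_sum (K := ℂ) (L := L) (H := H)) x y
  rw [LieAlgebra.restrict_killingForm] at this
  rw [this, Finset.sum_coe_sort H.root (fun γ => γ x * γ y)]
  simp
  rfl

/-- invariant form on weights -/
noncomputable def BF : LinearMap.BilinForm ℂ (Dual ℂ H) :=
  LinearMap.mk₂ ℂ (fun μ ν => μ (tt H ν)) (fun _ _ _ => rfl) (fun _ _ _ => rfl)
    (fun μ x y => by simp [tt]) (fun c μ x => by simp [tt])

lemma BF_apply (μ ν : Dual ℂ H) : BF H μ ν = μ (tt H ν) := rfl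

lemma BF_self (μ : Dual ℂ H) : BF H μ μ = ∑ γ : H.root, (γ.1 (tt H μ)) ^ 2 := by
  rw [BF_apply, apply_tt, trace_sum]
  simp [sq]

variable {H}

/-- half squared length -/
noncomputable def dd (γ : H.root) : ℝ := 2 / ∑ δ : H.root, ((rootSystem H).pairingIn ℤ δ γ : ℝ) ^ 2

lemma isNonZero (γ : H.root) : γ.1.IsNonZero := by
  have := γ.2
  exact (Finset.mem_filter.1 this).2

lemma dd_den_pos (γ : H.root) : 0 < ∑ δ : H.root, ((rootSystem H).pairingIn ℤ δ γ : ℝ) ^ 2 := by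
  refine Finset.sum_pos' (fun _ _ => sq_nonneg _) ⟨γ, Finset.mem_univ _, ?_⟩
  rw [RootPairing.pairingIn_same]
  norm_num

lemma dd_pos (γ : H.root) : 0 < dd γ := div_pos two_pos (dd_den_pos γ)

lemma pairing_cast (δ γ : H.root) : (((rootSystem H).pairingIn ℤ δ γ : ℤ) : ℂ) = δ.1 (coroot γ.1) := by
  have := (rootSystem H).algebraMap_pairingIn ℤ δ γ
  rw [rootSystem_pairing_apply] at this
  exact this

lemma coroot_tt (γ : H.root) : tt H γ.1.toLinear = (γ.1 (tt H γ.1.toLinear) / 2 : ℂ) • coroot γ.1 := by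
  have h := root_apply_cartanEquivDual_symm_ne_zero (isNonZero γ)
  rw [coroot, tt]
  rw [two_nsmul, ← add_smul, smul_smul]
  have : (γ.1 ((cartanEquivDual H).symm γ.1.toLinear) / 2 : ℂ) *
      ((γ.1 ((cartanEquivDual H).symm γ.1.toLinear))⁻¹ + (γ.1 ((cartanEquivDual H).symm γ.1.toLinear))⁻¹) = 1 := by
    field_simp
    norm_num
  rw [this, one_smul]

lemma root_tt (γ : H.root) : γ.1 (tt H γ.1.toLinear) / 2 = (dd γ : ℂ) := by
  have h : γ.1 (tt H γ.1.toLinear) ≠ 0 := root_apply_cartanEquivDual_symm_ne_zero (isNonZero γ)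
  have h1 := BF_self H γ.1.toLinear
  rw [BF_apply, Weight.toLinear_apply] at h1
  have h2 : ∀ δ : H.root, δ.1 (tt H γ.1.toLinear) =
      (γ.1 (tt H γ.1.toLinear) / 2) * (((rootSystem H).pairingIn ℤ δ γ : ℤ) : ℂ) := by
    intro δ
    rw [pairing_cast]
    conv_lhs => rw [coroot_tt]
    rw [← Weight.toLinear_apply, map_smul]
    rfl
  rw [Finset.sum_congr rfl fun δ _ => by rw [h2 δ, mul_pow], ← Finset.mul_sum] at h1
  have h3 : (∑ δ : H.root, (((rootSystem H).pairingIn ℤ δ γ : ℤ) : ℂ) ^ 2) ≠ 0 := by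
    have := (dd_den_pos γ).ne'
    exact_mod_cast this
  rw [dd]
  push_cast
  rw [eq_div_iff h3]
  generalize γ.1 (tt H γ.1.toLinear) = x at *
  generalize (∑ δ : H.root, (((rootSystem H).pairingIn ℤ δ γ : ℤ) : ℂ) ^ 2) = y at *
  have : x * (x / 2 * y - 2) = 0 := by linear_combination (-2) * h1
  rcases mul_eq_zero.1 this with h5 | h5
  · exact absurd h5 h
  · exact sub_eq_zero.1 h5

lemma BF_root (γ : H.root) (μ : Dual ℂ H) : BF H μ γ.1.toLinear = μ (coroot γ.1) * dd γ := by
  rw [BF_apply, coroot_tt, map_smul, root_tt, smul_eq_mul, mul_comm]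

variable (b : (rootSystem H).Base)

open Classical in
/-- The root datum of a Killing Lie algebra. -/
noncomputable def rd : RD (Dual ℂ H) b.support where
  α i := (i : H.root).1.toLinear
  pos := (Finset.univ.filter fun γ : H.root => b.IsPos γ).image fun γ => γ.1.toLinear
  B := BF H
  co i := Dual.eval ℂ H (coroot (i : H.root).1)
  d i := dd (i : H.root)
  A i j := (rootSystem H).pairingIn ℤ j i
  li := b.linearIndepOn_root
  Bsymm := apply_tt_symm H
  d_pos i := dd_pos _
  B_α i μ := BF_root _ μ
  co_α i j := by rw [pairing_cast]; rfl
  A_self i := by rw [RootPairing.pairingIn_same]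
  A_nonpos i j h := b.pairingIn_le_zero_of_ne (fun e => h (Subtype.ext e.symm)) j.2 i.2
  pos_mem := by
    intro x hx
    obtain ⟨γ, hγ, rfl⟩ := Finset.mem_image.1 hx
    have hγ' : b.IsPos γ := (Finset.mem_filter.1 hγ).2
    obtain ⟨f, hf, h | h⟩ := b.exists_root_eq_sum_nat_or_neg γ
    · refine ⟨Finsupp.equivFunOnFinite.symm fun i => f i, ?_, ?_⟩
      · intro h0
        have h1 : ∀ i ∈ b.support, f i = 0 := fun i hi => DFunLike.congr_fun h0 ⟨i, hi⟩
        rw [Finset.sum_eq_zero fun j hj => by rw [h1 j hj, zero_smul]] at h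
        exact (rootSystem H).ne_zero γ h
      · rw [← rootSystem_root_apply, h, ← Finset.sum_coe_sort]
        refine Finset.sum_congr rfl fun i _ => ?_
        rw [← Nat.cast_smul_eq_nsmul ℂ]
        rfl
    · exfalso
      rw [← Finset.sum_neg_distrib] at h
      have := RootPairing.Base.height_eq_sum (b := b) (i := γ) (f := fun j => - (f j : ℤ)) (by
        rw [h]; refine Finset.sum_congr rfl fun i _ => ?_; simp)
      rw [b.isPos_iff, this] at hγ'
      have : ∑ j ∈ b.support, - (f j : ℤ) ≤ 0 := Finset.sum_nonpos fun j _ => by simp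
      omega
  simple_mem i := Finset.mem_image.2 ⟨i, Finset.mem_filter.2
    ⟨Finset.mem_univ _, b.isPos_of_mem_support i.2⟩, rfl⟩
  perm i x hx hne := by
    obtain ⟨γ, hγ, rfl⟩ := Finset.mem_image.1 hx
    have hγ' : b.IsPos γ := (Finset.mem_filter.1 hγ).2
    have hne' : γ ≠ i := fun e => hne (by rw [e])
    refine Finset.mem_image.2 ⟨(rootSystem H).reflectionPerm i γ, Finset.mem_filter.2
      ⟨Finset.mem_univ _, hγ'.reflectionPerm i.2 hne'⟩, ?_⟩
    have := (rootSystem H).root_reflectionPerm i γ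
    rw [RootPairing.reflection_apply] at this
    exact this
  definite := by
    intro c hc
    let β : Dual ℂ H := ∑ i : b.support, (c i : ℂ) • (i : H.root).1.toLinear
    have key : ∀ μ : Dual ℂ H, BF H μ β =
        ∑ i : b.support, (c i : ℂ) * (μ (coroot (i : H.root).1) * dd (i : H.root)) := fun μ => by
      simp only [β, map_sum, map_smul, BF_root, smul_eq_mul]
    have e1 : BF H β β = ((∑ i : b.support, (c i : ℝ) * ((∑ j : b.support,
        (rootSystem H).pairingIn ℤ j i * (c j : ℤ) : ℤ) * dd (i : H.root)) : ℝ) : ℂ) := by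
      rw [key]
      push_cast
      refine Finset.sum_congr rfl fun i _ => ?_
      simp only [β, LinearMap.sum_apply, LinearMap.smul_apply, smul_eq_mul, pairing_cast]
      congr 2
      refine Finset.sum_congr rfl fun j _ => ?_
      rw [mul_comm]; rfl
    have e2 : ∀ γ : H.root, γ.1 (tt H β) = ((∑ i : b.support, (c i : ℝ) *
        ((rootSystem H).pairingIn ℤ γ i * dd (i : H.root)) : ℝ) : ℂ) := by
      intro γ
      have := key γ.1.toLinear
      rw [BF_apply, Weight.toLinear_apply] at this
      rw [this]
      push_cast
      simp only [pairing_cast]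
      rfl
    have e3 := BF_self H β
    rw [e1] at e3
    simp only [e2] at e3
    have e4 : (∑ i : b.support, (c i : ℝ) * ((∑ j : b.support,
        (rootSystem H).pairingIn ℤ j i * (c j : ℤ) : ℤ) * dd (i : H.root)) : ℝ) =
        ∑ γ : H.root, (∑ i : b.support, (c i : ℝ) *
        ((rootSystem H).pairingIn ℤ γ i * dd (i : H.root)) : ℝ) ^ 2 := by exact_mod_cast e3
    have e5 : (∑ i : b.support, (c i : ℝ) * ((∑ j : b.support,
        (rootSystem H).pairingIn ℤ j i * (c j : ℤ) : ℤ) * dd (i : H.root)) : ℝ) ≤ 0 := by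
      refine Finset.sum_nonpos fun i _ => ?_
      have h1 : ((∑ j : b.support, (rootSystem H).pairingIn ℤ j i * (c j : ℤ) : ℤ) : ℝ) ≤ 0 := by
        exact_mod_cast hc i
      have := dd_pos (i : H.root)
      exact mul_nonpos_of_nonneg_of_nonpos (Nat.cast_nonneg _)
        (mul_nonpos_of_nonpos_of_nonneg h1 this.le)
    rw [e4] at e5
    have e6 := (Finset.sum_eq_zero_iff_of_nonneg (fun _ _ => sq_nonneg _)).1
      (le_antisymm e5 (Finset.sum_nonneg fun _ _ => sq_nonneg _))
    have e7 : ∀ γ : H.root, γ.1 (tt H β) = 0 := fun γ => by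
      rw [e2, pow_eq_zero_iff two_ne_zero |>.1 (e6 γ (Finset.mem_univ _))]; simp
    have e8 : tt H β = 0 := by
      have h0 : ∀ x, traceForm ℂ H L (tt H β) x = 0 := fun x => by
        rw [trace_sum]; simp [e7]
      have : β = 0 := by
        ext x
        rw [← killing_tt]
        exact h0 x
      rw [this]; simp [tt]
    have e9 : β = 0 := by simpa [tt] using e8
    have := Fintype.linearIndependent_iff.1 b.linearIndepOn_root _ e9
    ext i
    exact_mod_cast this i

end
end UF

namespace UF
open LieAlgebra LieAlgebra.IsKilling LieModule Module

section
variable {L : Type*} [LieRing L] [LieAlgebra ℂ L] [FiniteDimensional ℂ L] [IsKilling ℂ L]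
  [LieAlgebra.IsSimple ℂ L]
  {H : LieSubalgebra ℂ L} [H.IsCartanSubalgebra] (b : (rootSystem H).Base)

lemma conn [DecidableEq b.support] (v : b.support) : Comb.Conn (rd b).adj (Finset.univ.erase v) (Comb.nbr (rd b).adj v) := by
  intro C hC hne hcl
  by_contra hcon
  push Not at hcon
  obtain ⟨i0, hi0⟩ := hne
  have hv : v ∈ C := by
    refine b.induction_on_cartanMatrix (fun k : b.support => k ∈ C) hi0 ?_
    intro i j hi hij
    by_cases hji : i = j
    · exact hji ▸ hi
    have hij' : (rd b).adj i j := by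
      refine ⟨hji, ?_⟩
      exact hij
    have hji' : (rd b).adj j i := by
      refine ⟨Ne.symm hji, ?_⟩
      intro h
      exact hij'.2 (((rootSystem H).pairingIn_eq_zero_iff (S := ℤ)).1 h)
    by_cases hjv : j = v
    · subst hjv
      exact absurd (by simpa [Comb.nbr] using hji') (hcon i hi)
    · exact hcl i hi j (by simp [hjv]) hij'
  exact absurd (hC hv) (by simp)

end

lemma exists_base (L : Type*) [LieRing L] [LieAlgebra ℂ L] [FiniteDimensional ℂ L]
    [LieAlgebra.IsSimple ℂ L] : ∃ (_ : IsKilling ℂ L) (H : LieSubalgebra ℂ L)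
      (_ : H.IsCartanSubalgebra) (b : (rootSystem H).Base), Nonempty b.support := by
  have i1 : IsKilling ℂ L := inferInstance
  obtain ⟨x, hx⟩ := LieAlgebra.exists_isCartanSubalgebra_engel ℂ L
  let H := LieSubalgebra.engel ℂ x
  refine ⟨i1, H, hx, ?_⟩
  obtain ⟨b⟩ := (rootSystem H).nonempty_base
  refine ⟨b, ?_⟩
  have h1 : Nonempty H.root := by
    by_contra hE
    rw [not_nonempty_iff] at hE
    have h2 := RootPairing.IsRootSystem.span_root_eq_top (P := rootSystem H)
    rw [Set.range_eq_empty, Submodule.span_empty] at h2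
    have h3 := (instIsIrreducibleRootSystem_of_isSimple (K := ℂ) (L := L) (H := H)).nontrivial
    exact bot_ne_top h2
  exact b.support_nonempty.to_subtype
end UF

namespace UF
open LieAlgebra LieAlgebra.IsKilling LieModule Module

set_option linter.unusedSectionVars false
section WB
variable {L : Type*} [LieRing L] [LieAlgebra ℂ L] (H : LieSubalgebra ℂ L)
  {V : Type*} [AddCommGroup V] [Module ℂ V] [LieRingModule L V] [LieModule ℂ L V]

variable (V) in
/-- weight space -/
def WS (μ : Dual ℂ H) : Submodule ℂ V where
  carrier := {v | ∀ h : H, ⁅(h : L), v⁆ = μ h • v}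
  add_mem' {v w} hv hw h := by rw [lie_add, hv h, hw h, smul_add]
  zero_mem' h := by simp
  smul_mem' c v hv h := by rw [lie_smul, hv h, smul_comm]

lemma mem_WS {μ : Dual ℂ H} {v : V} : v ∈ WS H V μ ↔ ∀ h : H, ⁅(h : L), v⁆ = μ h • v := Iff.rfl

/-- weight basis -/
def IsWB {I : Type*} (bas : Basis I ℂ V) (wt : I → Dual ℂ H) : Prop :=
  ∀ i, bas i ∈ WS H V (wt i)

/-- formal character -/
noncomputable def chr {I : Type*} [Fintype I] (wt : I → Dual ℂ H) : GA (Dual ℂ H) := ∑ i, ee (wt i)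

variable {H}

lemma lie_WS {γ μ : Dual ℂ H} {x : L} {v : V} (hx : x ∈ WS H L γ) (hv : v ∈ WS H V μ) :
    ⁅x, v⁆ ∈ WS H V (γ + μ) := by
  intro h
  rw [leibniz_lie, hx h, hv h, smul_lie, lie_smul, ← add_smul]
  rfl

namespace IsWB
variable {I : Type*} [Fintype I] {bas : Basis I ℂ V} {wt : I → Dual ℂ H} (hb : IsWB H bas wt)
include hb

lemma repr_lie (h : H) (v : V) (i : I) : bas.repr ⁅(h : L), v⁆ i = wt i h * bas.repr v i := by
  classical
  have : ∀ v, bas.coord i (toEnd ℂ L V h v) = (wt i h • bas.coord i) v := by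
    intro v
    refine LinearMap.congr_fun (f := bas.coord i ∘ₗ toEnd ℂ L V h) (bas.ext fun j => ?_) v
    simp only [LinearMap.comp_apply, toEnd_apply_apply, hb j h, map_smul, LinearMap.smul_apply,
      Basis.coord_apply, Basis.repr_self, smul_eq_mul, Finsupp.single_apply]
    split_ifs with hij
    · rw [hij]
    · simp
  exact this v

lemma mem_iff (μ : Dual ℂ H) (v : V) : v ∈ WS H V μ ↔ ∀ i, wt i ≠ μ → bas.repr v i = 0 := by
  constructor
  · intro hv i hi
    by_contra hne
    apply hi
    ext h
    have := hb.repr_lie h v i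
    rw [hv h, map_smul, Finsupp.smul_apply, smul_eq_mul] at this
    exact (mul_right_cancel₀ hne this).symm
  · intro hv h
    apply bas.repr.injective
    ext i
    rw [hb.repr_lie, map_smul, Finsupp.smul_apply, smul_eq_mul]
    by_cases hi : wt i = μ
    · rw [hi]
    · rw [hv i hi]; simp

open Classical in
lemma finrank_WS (μ : Dual ℂ H) : finrank ℂ (WS H V μ) = (Finset.univ.filter fun i => wt i = μ).card := by
  have h1 : WS H V μ = Submodule.span ℂ (Set.range fun i : {i // wt i = μ} => bas i) := by
    ext v
    have : (Set.range fun i : {i // wt i = μ} => bas i) = Set.image bas {i | wt i = μ} := by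
      ext; simp
    rw [hb.mem_iff, this, bas.mem_span_image]
    constructor
    · intro h i hi
      by_contra hne
      exact Finsupp.mem_support_iff.1 hi (h i hne)
    · intro h i hi
      by_contra hne
      exact hi (h (Finsupp.mem_support_iff.2 hne))
  have h2 : LinearIndependent ℂ (fun i : {i // wt i = μ} => bas i) :=
    bas.linearIndependent.comp _ Subtype.val_injective
  rw [h1, finrank_span_eq_card h2, Fintype.card_subtype]

lemma coeff_chr (μ : Dual ℂ H) : (chr H wt).coeff μ = finrank ℂ (WS H V μ) := by
  classical
  rw [hb.finrank_WS, chr, AddMonoidAlgebra.coeff_sum, Finsupp.finsetSum_apply]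
  simp [ee, Finsupp.single_apply]

lemma chr_eq {V' : Type*} [AddCommGroup V'] [Module ℂ V'] [LieRingModule L V'] [LieModule ℂ L V']
    {I' : Type*} [Fintype I'] {bas' : Basis I' ℂ V'} {wt' : I' → Dual ℂ H} (hb' : IsWB H bas' wt')
    (f : V ≃ₗ⁅ℂ,L⁆ V') : chr H wt = chr H wt' := by
  ext μ
  rw [hb.coeff_chr, hb'.coeff_chr]
  congr 1
  refine LinearEquiv.finrank_eq (f.toLinearEquiv.ofSubmodules _ _ ?_)
  ext v
  constructor
  · rintro ⟨w, hw, rfl⟩ h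
    have := congrArg f (hw h)
    erw [LieModuleHom.map_lie] at this
    rw [map_smul] at this
    exact this
  · intro hv
    refine ⟨f.symm v, fun h => ?_, f.apply_symm_apply v⟩
    have := congrArg f.symm (hv h)
    erw [LieModuleHom.map_lie] at this
    rw [map_smul] at this
    exact this

end IsWB

open scoped TensorProduct in
lemma IsWB.tensor {I : Type*} {bas : Basis I ℂ V} {wt : I → Dual ℂ H}
    (hb : IsWB H bas wt) {V' : Type*} [AddCommGroup V'] [Module ℂ V'] [LieRingModule L V']
    [LieModule ℂ L V'] {I' : Type*} {bas' : Basis I' ℂ V'} {wt' : I' → Dual ℂ H}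
    (hb' : IsWB H bas' wt') :
    IsWB H (V := V ⊗[ℂ] V') (bas.tensorProduct bas') (fun p => wt p.1 + wt' p.2) := by
  intro p h
  rw [Basis.tensorProduct_apply, TensorProduct.LieModule.lie_tmul_right, hb p.1 h, hb' p.2 h,
    TensorProduct.tmul_smul, ← TensorProduct.smul_tmul', ← add_smul]
  rfl

lemma chr_tensor {I I' : Type*} [Fintype I] [Fintype I'] (wt : I → Dual ℂ H) (wt' : I' → Dual ℂ H) :
    chr H (fun p : I × I' => wt p.1 + wt' p.2) = chr H wt * chr H wt' := by
  rw [chr, chr, chr, Finset.sum_mul_sum, Fintype.sum_prod_type]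
  simp only [ee_add]

lemma exists_WB [FiniteDimensional ℂ V] (h : Submodule.span ℂ {v : V | ∃ μ, v ∈ WS H V μ} = ⊤) :
    ∃ (m : ℕ) (bas : Basis (Fin m) ℂ V) (wt : Fin m → Dual ℂ H), IsWB H bas wt := by
  obtain ⟨s, hs, hsp, hli⟩ := exists_linearIndependent ℂ {v : V | ∃ μ, v ∈ WS H V μ}
  let B : Basis s ℂ V := Basis.mk hli (by rw [Subtype.range_coe, hsp, h])
  have : Finite s := Module.Finite.finite_basis B
  have : Fintype s := Fintype.ofFinite s
  choose w hw using fun i : s => hs i.2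
  refine ⟨Fintype.card s, B.reindex (Fintype.equivFin s), w ∘ (Fintype.equivFin s).symm, fun i => ?_⟩
  rw [Basis.reindex_apply, Basis.mk_apply]
  exact hw _

end WB

section
variable {L : Type*} [LieRing L] [LieAlgebra ℂ L] [FiniteDimensional ℂ L] [IsKilling ℂ L]
  (H : LieSubalgebra ℂ L) [H.IsCartanSubalgebra]
  {V : Type*} [AddCommGroup V] [Module ℂ V] [LieRingModule L V] [LieModule ℂ L V]

lemma rootSpace_le (γ : Weight ℂ H L) : (rootSpace H γ : Submodule ℂ L) ≤ WS H L γ.toLinear := by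
  intro x hx h
  exact lie_eq_smul_of_mem_rootSpace hx h

lemma WS_eq (γ : Weight ℂ H L) : (rootSpace H γ : Submodule ℂ L) = WS H L γ.toLinear := by
  refine le_antisymm (rootSpace_le H γ) ?_
  intro x hx
  refine weightSpace_le_genWeightSpace L γ ?_
  rw [mem_weightSpace]
  exact hx

/-- a nonzero root vector with nonzero weight gives a root -/
lemma root_of_WS {μ : Dual ℂ H} (hμ : μ ≠ 0) {x : L} (hx : x ∈ WS H L μ) (h0 : x ≠ 0) :
    ∃ γ : H.root, γ.1.toLinear = μ := by
  have hx' : x ∈ rootSpace H μ := by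
    refine weightSpace_le_genWeightSpace L μ ?_
    rw [mem_weightSpace]
    exact hx
  let γ : Weight ℂ H L := ⟨μ, fun h => h0 (by
    have h2 : x ∈ genWeightSpace L (μ : H → ℂ) := hx'
    rw [h] at h2
    simpa using h2)⟩
  have hγ : γ.toLinear = μ := by ext; rfl
  refine ⟨⟨γ, ?_⟩, hγ⟩
  rw [LieSubalgebra.root, Finset.mem_filter]
  refine ⟨Finset.mem_univ _, fun h => hμ ?_⟩
  rw [← hγ]
  ext t
  exact congrFun h t

lemma mem_H_of_WS {x : L} (hx : x ∈ WS H L 0) : x ∈ H := by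
  have hx' : x ∈ rootSpace H (0 : H → ℂ) := by
    refine weightSpace_le_genWeightSpace L _ ?_
    rw [mem_weightSpace]
    exact hx
  simpa using hx'

lemma span_WS_L : Submodule.span ℂ {v : L | ∃ μ, v ∈ WS H L μ} = ⊤ := by
  have h1 := iSup_genWeightSpace_eq_top' ℂ H L
  rw [eq_top_iff, ← LieSubmodule.top_toSubmodule (R := ℂ) (L := H) (M := L), ← h1, LieSubmodule.iSup_toSubmodule, iSup_le_iff]
  intro γ x hx
  exact Submodule.subset_span ⟨γ.toLinear, rootSpace_le H γ hx⟩

/-- submodule criterion -/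
lemma lie_mem_of_WS {U : Submodule ℂ V} {v : V} (h : ∀ γ, ∀ x ∈ WS H L γ, ⁅x, v⁆ ∈ U) (x : L) : ⁅x, v⁆ ∈ U := by
  have hx : x ∈ Submodule.span ℂ {v : L | ∃ μ, v ∈ WS H L μ} := by rw [span_WS_L]; trivial
  induction hx using Submodule.span_induction with
  | mem x hx => obtain ⟨γ, hγ⟩ := hx; exact h γ x hγ
  | zero => simp
  | add x y _ _ hx hy => rw [add_lie]; exact U.add_mem hx hy
  | smul c x _ hx => rw [smul_lie]; exact U.smul_mem c hx

lemma irr_top [LieModule.IsIrreducible ℂ L V] (U : Submodule ℂ V) (hU : ∀ (x : L), ∀ v ∈ U, ⁅x, v⁆ ∈ U)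
    (v : V) (hv : v ∈ U) (h0 : v ≠ 0) : U = ⊤ := by
  let N : LieSubmodule ℂ L V := { U with lie_mem := fun {x m} hm => hU x m hm }
  rcases IsSimpleOrder.eq_bot_or_eq_top N with h | h
  · exact absurd (show v ∈ N from hv) (by rw [h]; simpa using h0)
  · rw [← LieSubmodule.toSubmodule_eq_top] at h; exact h

lemma irr_nontrivial [LieModule.IsIrreducible ℂ L V] : Nontrivial V := by
  by_contra hn
  rw [not_nontrivial_iff_subsingleton] at hn
  exact (bot_ne_top : (⊥ : LieSubmodule ℂ L V) ≠ ⊤) (Subsingleton.elim _ _)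

lemma exists_WS_ne [FiniteDimensional ℂ V] [Nontrivial V] : ∃ (μ : Dual ℂ H) (v : V), v ∈ WS H V μ ∧ v ≠ 0 := by
  obtain ⟨μ, hμ⟩ := LieModule.exists_nontrivial_weightSpace_of_isSolvable ℂ H V
  obtain ⟨⟨v, hv⟩, hv0⟩ := exists_ne (0 : weightSpace V μ)
  refine ⟨μ, v, ?_, fun h => hv0 (Subtype.ext h)⟩
  rw [mem_weightSpace] at hv
  exact hv

lemma span_WS_irr [FiniteDimensional ℂ V] [LieModule.IsIrreducible ℂ L V] :
    Submodule.span ℂ {v : V | ∃ μ, v ∈ WS H V μ} = ⊤ := by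
  have := irr_nontrivial (L := L) (V := V)
  obtain ⟨μ, v, hv, h0⟩ := exists_WS_ne H (V := V)
  refine irr_top (L := L) _ ?_ v (Submodule.subset_span ⟨μ, hv⟩) h0
  intro x w hw
  induction hw using Submodule.span_induction with
  | mem w hw =>
    obtain ⟨ν, hν⟩ := hw
    exact lie_mem_of_WS H (U := Submodule.span ℂ {v : V | ∃ μ, v ∈ WS H V μ})
      (fun γ y hy => Submodule.subset_span ⟨_, lie_WS hy hν⟩) x
  | zero => simp
  | add w w' _ _ hw hw' => rw [lie_add]; exact add_mem hw hw'
  | smul c w _ hw => rw [lie_smul]; exact Submodule.smul_mem _ _ hw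

end
end UF

namespace UF
open LieAlgebra LieAlgebra.IsKilling LieModule Module

set_option linter.unusedSectionVars false
section Exp
variable {A : Type*} [Ring A] [Algebra ℂ A]

/-- truncated exponential -/
noncomputable def ex (a : A) (N : ℕ) : A := ∑ n ∈ Finset.range N, ((n.factorial : ℂ)⁻¹) • a ^ n

lemma ex_succ {a : A} {N : ℕ} (hN : a ^ N = 0) : ex a (N + 1) = ex a N := by
  rw [ex, Finset.sum_range_succ, hN, smul_zero, add_zero, ex]

lemma fac_inv (n : ℕ) : (((n + 1).factorial : ℂ)⁻¹) * ((n : ℂ) + 1) = (n.factorial : ℂ)⁻¹ := by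
  have h1 : (n.factorial : ℂ) ≠ 0 := by exact_mod_cast n.factorial_ne_zero
  have h2 : (n : ℂ) + 1 ≠ 0 := by exact_mod_cast n.succ_ne_zero
  rw [Nat.factorial_succ]
  push_cast
  field_simp

lemma ex_isUnit {a : A} {N : ℕ} (hN : a ^ N = 0) : IsUnit (ex a N) := by
  rw [← ex_succ hN]
  have : ex a (N + 1) = 1 + a * ∑ n ∈ Finset.range N, (((n + 1).factorial : ℂ)⁻¹) • a ^ n := by
    rw [ex, Finset.sum_range_succ', add_comm, Finset.mul_sum]
    simp [pow_succ']
  rw [this]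
  refine IsNilpotent.isUnit_one_add ?_
  refine Commute.isNilpotent_mul_right ?_ ⟨N, hN⟩
  refine Commute.sum_right _ _ _ fun n _ => ?_
  exact ((Commute.refl a).pow_right n).smul_right _

lemma ex_sum {a : A} {N : ℕ} (hN : a ^ N = 0) :
    ∑ n ∈ Finset.range N, ((n.factorial : ℂ)⁻¹ * n) • a ^ n = a * ex a N := by
  have h1 : ∑ n ∈ Finset.range (N + 1), ((n.factorial : ℂ)⁻¹ * n) • a ^ n =
      ∑ n ∈ Finset.range N, ((n.factorial : ℂ)⁻¹ * n) • a ^ n := by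
    rw [Finset.sum_range_succ, hN, smul_zero, add_zero]
  rw [← h1, Finset.sum_range_succ', ex, Finset.mul_sum]
  simp only [Nat.cast_zero, mul_zero, zero_smul, add_zero]
  refine Finset.sum_congr rfl fun n _ => ?_
  rw [Nat.cast_add, Nat.cast_one, fac_inv, pow_succ', mul_smul_comm]

variable {e f h : A} (he : e * h = h * e - 2 * e) (hf : e * f = f * e + h)
include he

lemma pow_h (n : ℕ) : e ^ n * h = h * e ^ n - (2 * n : ℂ) • e ^ n := by
  induction n with
  | zero => simp
  | succ n ih =>
    rw [pow_succ', mul_assoc, ih, mul_sub, ← mul_assoc, he, mul_smul_comm, ← pow_succ', sub_mul,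
      mul_assoc, mul_assoc, ← pow_succ', two_mul]
    push_cast
    module

lemma ex_h {N : ℕ} (hN : e ^ N = 0) : ex e N * h = (h - 2 * e) * ex e N := by
  rw [sub_mul, mul_assoc, ← ex_sum hN, ex, Finset.sum_mul, Finset.mul_sum, Finset.mul_sum,
    ← Finset.sum_sub_distrib]
  refine Finset.sum_congr rfl fun n _ => ?_
  have h2 : ∀ x : A, 2 * x = (2 : ℂ) • x := fun x => by rw [two_mul, two_smul]
  rw [smul_mul_assoc, pow_h he, h2, mul_smul_comm]
  module

include hf

lemma pow_f (n : ℕ) : e ^ (n + 1) * f = f * e ^ (n + 1) + ((n : ℂ) + 1) • (h * e ^ n) -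
    (((n : ℂ) + 1) * n) • e ^ n := by
  induction n with
  | zero => simp [hf]
  | succ n ih =>
    rw [pow_succ' e (n + 1), mul_assoc, ih, mul_sub, mul_add, mul_smul_comm, mul_smul_comm, ← mul_assoc,
      ← mul_assoc, hf, he, ← pow_succ']
    simp only [sub_mul, add_mul, mul_assoc, ← pow_succ', two_mul]
    push_cast
    module

lemma ex_f {N : ℕ} (hN : e ^ N = 0) : ex e N * f = (f + h - e) * ex e N := by
  have h1 : ex e N * f = f * ex e (N + 1) + h * ex e N - ∑ n ∈ Finset.range N, ((n.factorial : ℂ)⁻¹ * n) • e ^ n := by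
    have h0 : ex e (N + 1) = ∑ n ∈ Finset.range N, (((n + 1).factorial : ℂ)⁻¹) • e ^ (n + 1) + 1 := by
      rw [ex, Finset.sum_range_succ']
      simp
    have h00 := ex_succ hN
    rw [h00] at h0
    conv_lhs => rw [h0]
    rw [h00]
    conv_rhs => enter [1, 1]; rw [h0]
    rw [ex, add_mul, mul_add, Finset.sum_mul, Finset.mul_sum,
      Finset.mul_sum, add_right_comm, add_sub_right_comm, ← Finset.sum_add_distrib, ← Finset.sum_sub_distrib]
    congr 1
    · refine Finset.sum_congr rfl fun n _ => ?_
      rw [smul_mul_assoc, pow_f he hf, ← fac_inv n]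
      simp only [mul_smul_comm]
      module
    · simp
  rw [h1, ex_succ hN, ex_sum hN]
  noncomm_ring

end Exp

section Exp2
variable {A : Type*} [Ring A] [Algebra ℂ A]

/-- the Weyl group representative -/
lemma exists_theta {e f h : A} (h1 : h * e - e * h = 2 * e) (h2 : h * f - f * h = - (2 * f))
    (h3 : e * f - f * e = h) (ne : IsNilpotent e) (nf : IsNilpotent f) :
    ∃ θ : A, IsUnit θ ∧ θ * h = - h * θ ∧ ∀ t, Commute t e → Commute t f → θ * t = t * θ := by
  obtain ⟨N, hN⟩ := ne
  obtain ⟨M, hM⟩ := nf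
  have hM' : (-f) ^ M = 0 := by rw [neg_pow, hM, mul_zero]
  have a1 : e * h = h * e - 2 * e := by rw [← h1]; abel
  have a2 : e * f = f * e + h := by rw [← h3]; abel
  have b1 : (-f) * (-h) = (-h) * (-f) - 2 * (-f) := by
    have : f * h = h * f + 2 * f := by rw [eq_comm, ← sub_eq_zero, ← sub_eq_zero.2 h2]; abel
    rw [neg_mul_neg, this]; noncomm_ring
  have b2 : (-f) * (-e) = (-e) * (-f) + (-h) := by rw [neg_mul_neg, neg_mul_neg, a2]; abel
  have E1 := ex_h a1 hN
  have F1 := ex_h b1 hM'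
  have F2 := ex_f b1 b2 hM'
  refine ⟨ex e N * (ex (-f) M * ex e N), (ex_isUnit hN).mul ((ex_isUnit hM').mul (ex_isUnit hN)), ?_, ?_⟩
  · have F1' : ex (-f) M * h = (h - 2 * f) * ex (-f) M := by
      have := congrArg Neg.neg F1
      rw [← mul_neg, neg_neg, ← neg_mul] at this
      rw [this]; congr 1; noncomm_ring
    have F2' : ex (-f) M * e = (e + h - f) * ex (-f) M := by
      have := congrArg Neg.neg F2
      rw [← mul_neg, neg_neg, ← neg_mul] at this
      rw [this]; congr 1; noncomm_ring
    have F3 : ex (-f) M * (h - 2 * e) = (- h - 2 * e) * ex (-f) M := by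
      have : ex (-f) M * (h - 2 * e) = ex (-f) M * h - 2 * (ex (-f) M * e) := by noncomm_ring
      rw [this, F1', F2']; noncomm_ring
    have E2 : ex e N * (- h - 2 * e) = - h * ex e N := by
      have hc : Commute e (ex e N) := Commute.sum_right _ _ _ fun n _ =>
        ((Commute.refl e).pow_right n).smul_right _
      have : ex e N * (- h - 2 * e) = - (ex e N * h) - 2 * (ex e N * e) := by noncomm_ring
      rw [this, E1, ← hc.eq]; noncomm_ring
    rw [mul_assoc, mul_assoc, E1, ← mul_assoc (ex (-f) M), F3, mul_assoc, ← mul_assoc, E2, mul_assoc]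
  · intro t te tf
    have c1 : Commute t (ex e N) := Commute.sum_right _ _ _ fun n _ => (te.pow_right n).smul_right _
    have c2 : Commute t (ex (-f) M) := Commute.sum_right _ _ _ fun n _ =>
      (tf.neg_right.pow_right n).smul_right _
    exact ((c1.mul_right (c2.mul_right c1)).eq).symm

end Exp2

section
variable {L : Type*} [LieRing L] [LieAlgebra ℂ L] [FiniteDimensional ℂ L] [IsKilling ℂ L]
  {H : LieSubalgebra ℂ L} [H.IsCartanSubalgebra]
  {V : Type*} [AddCommGroup V] [Module ℂ V] [LieRingModule L V] [LieModule ℂ L V] [FiniteDimensional ℂ V]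

lemma toEnd_br (x y : L) : toEnd ℂ L V x * toEnd ℂ L V y - toEnd ℂ L V y * toEnd ℂ L V x =
    toEnd ℂ L V ⁅x, y⁆ := by
  ext v
  simp

/-- existence of sl2 triples in the form we need -/
lemma exists_sl2 (γ : H.root) : ∃ e f : L, e ∈ WS H L γ.1.toLinear ∧ f ∈ WS H L (-γ.1.toLinear) ∧
    IsSl2Triple (coroot γ.1 : L) e f ∧ e ∈ rootSpace H γ.1 ∧ f ∈ rootSpace H (-γ.1) := by
  obtain ⟨h, e, f, ht, he, hf⟩ := exists_isSl2Triple_of_weight_isNonZero (isNonZero γ)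
  have := ht.h_eq_coroot (isNonZero γ) he hf
  subst this
  refine ⟨e, f, rootSpace_le H _ he, ?_, ht, he, hf⟩
  have := rootSpace_le H (-γ.1) hf
  convert this using 1
  ext; simp

lemma refl_le (γ : H.root) (μ : Dual ℂ H) :
    finrank ℂ (WS H V μ) ≤ finrank ℂ (WS H V (μ - μ (coroot γ.1) • γ.1.toLinear)) := by
  obtain ⟨e, f, he, hf, ht, he', hf'⟩ := exists_sl2 γ
  let φ := toEnd ℂ L V
  have hn1 : _root_.IsNilpotent (φ e) := LieModule.isNilpotent_toEnd_of_mem_rootSpace (M := V) H (χ := γ.1)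
    (by exact isNonZero γ) he'
  have hn2 : _root_.IsNilpotent (φ f) := LieModule.isNilpotent_toEnd_of_mem_rootSpace (M := V) H (χ := -γ.1)
    (neg_ne_zero.2 (isNonZero γ)) hf'
  obtain ⟨θ, hu, hh, hc⟩ := exists_theta (A := End ℂ V) (e := φ e) (f := φ f) (h := φ (coroot γ.1))
    (by rw [toEnd_br, ht.lie_h_e_nsmul, map_nsmul]; simp [two_mul, φ])
    (by rw [toEnd_br, ht.lie_h_f_nsmul, map_neg, map_nsmul]; simp [two_mul, φ])
    (by rw [toEnd_br, ht.lie_e_f]) hn1 hn2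
  have h2 : γ.1 (coroot γ.1) = 2 := root_apply_coroot (isNonZero γ)
  have key : ∀ t : H, θ * φ t = φ ((t - γ.1 t • coroot γ.1 : H) : L) * θ := by
    intro t
    let t' : H := t - (γ.1 t / 2 : ℂ) • coroot γ.1
    have ht' : (γ.1.toLinear : Dual ℂ H) t' = 0 := by
      simp only [t', map_sub, map_smul, Weight.toLinear_apply, h2, smul_eq_mul]; ring
    have ce : Commute (φ t') (φ e) := by
      rw [Commute, SemiconjBy, ← sub_eq_zero, toEnd_br, he t', ht', zero_smul, map_zero]
    have cf : Commute (φ t') (φ f) := by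
      rw [Commute, SemiconjBy, ← sub_eq_zero, toEnd_br, hf t', LinearMap.neg_apply, ht', neg_zero, zero_smul, map_zero]
    have := hc _ ce cf
    have e1 : (t : L) = (t' : L) + (γ.1 t / 2 : ℂ) • (coroot γ.1 : L) := by
      simp [t']
    have e2 : ((t - γ.1 t • coroot γ.1 : H) : L) = (t' : L) - (γ.1 t / 2 : ℂ) • (coroot γ.1 : L) := by
      simp only [t', AddSubgroupClass.coe_sub, SetLike.val_smul]
      module
    rw [e1, e2, map_add, map_sub, mul_add, this, map_smul, mul_smul_comm, hh, sub_mul, smul_mul_assoc]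
    simp [sub_eq_add_neg]
  have hinj : Function.Injective θ := ((Module.End.isUnit_iff _).1 hu).1
  refine LinearMap.finrank_le_finrank_of_injective
    (f := θ.restrict (p := WS H V μ) (q := WS H V (μ - μ (coroot γ.1) • γ.1.toLinear)) ?_) ?_
  · intro v hv t
    have k := LinearMap.congr_fun (key (t - γ.1 t • coroot γ.1)) v
    have e3 : (t - γ.1 t • coroot γ.1) - γ.1 (t - γ.1 t • coroot γ.1) • coroot γ.1 = t := by
      have : γ.1 (t - γ.1 t • coroot γ.1) = - γ.1 t := by
        rw [← Weight.toLinear_apply, map_sub, map_smul, Weight.toLinear_apply, Weight.toLinear_apply, h2,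
          smul_eq_mul]; ring
      rw [this]; module
    rw [e3] at k
    simp only [Module.End.mul_apply, φ, toEnd_apply_apply] at k
    rw [← k, hv, map_smul]
    congr 1
    simp [mul_comm]
  · intro v w hvw
    exact Subtype.ext (hinj (congrArg Subtype.val hvw))

lemma refl_eq (γ : H.root) (μ : Dual ℂ H) :
    finrank ℂ (WS H V (μ - μ (coroot γ.1) • γ.1.toLinear)) = finrank ℂ (WS H V μ) := by
  refine le_antisymm ?_ (refl_le γ μ)
  have := refl_le (V := V) γ (μ - μ (coroot γ.1) • γ.1.toLinear)
  have h2 : γ.1 (coroot γ.1) = 2 := root_apply_coroot (isNonZero γ)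
  have e : μ - μ (coroot γ.1) • γ.1.toLinear - (μ - μ (coroot γ.1) • γ.1.toLinear) (coroot γ.1) • γ.1.toLinear = μ := by
    simp only [LinearMap.sub_apply, LinearMap.smul_apply, Weight.toLinear_apply, h2, smul_eq_mul]
    module
  rwa [e] at this

end
end UF

namespace UF
open LieAlgebra LieAlgebra.IsKilling LieModule Module

set_option linter.unusedSectionVars false
section
variable {L : Type*} [LieRing L] [LieAlgebra ℂ L] [FiniteDimensional ℂ L] [IsKilling ℂ L]
  {H : LieSubalgebra ℂ L} [H.IsCartanSubalgebra]
  {V : Type*} [AddCommGroup V] [Module ℂ V] [LieRingModule L V] [LieModule ℂ L V]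

section Gtr
variable {I : Type*} [Fintype I] (bas : Basis I ℂ V) (wt : I → Dual ℂ H)

/-- graded trace -/
noncomputable def gtr : End ℂ V →ₗ[ℂ] GA (Dual ℂ H) where
  toFun X := ∑ j, bas.repr (X (bas j)) j • ee (wt j)
  map_add' X Y := by simp [add_smul, Finset.sum_add_distrib]
  map_smul' c X := by simp [Finset.smul_sum, smul_smul]

lemma gtr_apply (X : End ℂ V) : gtr bas wt X = ∑ j, bas.repr (X (bas j)) j • ee (wt j) := rfl

variable {bas wt}

lemma gtr_comm (hb : IsWB H bas wt) {γ : Dual ℂ H} {x : L} (hx : x ∈ WS H L γ) (Y : End ℂ V) :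
    gtr bas wt (toEnd ℂ L V x * Y) = ee γ * gtr bas wt (Y * toEnd ℂ L V x) := by
  have h1 : ∀ (X Y : End ℂ V) j, bas.repr ((X * Y) (bas j)) j =
      ∑ k, bas.repr (Y (bas j)) k * bas.repr (X (bas k)) j := by
    intro X Y j
    rw [Module.End.mul_apply]
    conv_lhs => rw [← bas.sum_repr (Y (bas j))]
    simp only [map_sum, map_smul, Finsupp.finsetSum_apply, Finsupp.smul_apply, smul_eq_mul]
  rw [gtr_apply, gtr_apply, Finset.mul_sum]
  simp only [h1, Finset.sum_smul, mul_smul_comm, Finset.mul_sum]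
  rw [Finset.sum_comm]
  refine Finset.sum_congr rfl fun k _ => Finset.sum_congr rfl fun j _ => ?_
  rw [← ee_add, mul_comm]
  by_cases h : wt j = γ + wt k
  · rw [h]
  · have := (hb.mem_iff _ _).1 (lie_WS hx (hb k)) j h
    rw [toEnd_apply_apply, this]
    simp

lemma gtr_H (hb : IsWB H bas wt) (b : (rootSystem H).Base) (γ : Dual ℂ H) :
    gtr bas wt (toEnd ℂ L V (tt H γ : H)) = (rd b).pd γ (chr H wt) := by
  rw [gtr_apply, chr, map_sum]
  refine Finset.sum_congr rfl fun j _ => ?_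
  rw [toEnd_apply_apply, hb j, RD.pd, mulc_ee]
  simp only [map_smul, Finsupp.smul_apply, Basis.repr_self, Finsupp.single_eq_same, smul_eq_mul, mul_one]
  congr 1
  exact apply_tt_symm H _ _

lemma gtr_one : gtr bas wt 1 = chr H wt := by
  simp [gtr_apply, chr]

end Gtr

section Cas
variable {m : ℕ} (xb : Basis (Fin m) ℂ L)

/-- Killing-dual basis -/
noncomputable def yb : Basis (Fin m) ℂ L :=
  LinearMap.BilinForm.dualBasis (killingForm ℂ L) (killingForm_nondegenerate ℂ L) xb

lemma yb_repr (z : L) (i : Fin m) : (yb xb).repr z i = killingForm ℂ L z (xb i) :=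
  LinearMap.BilinForm.dualBasis_repr_apply _ _ _ _

lemma killing_yb (i j : Fin m) : killingForm ℂ L (yb xb i) (xb j) = if j = i then 1 else 0 :=
  LinearMap.BilinForm.apply_dualBasis_left _ _ _ _

lemma xb_repr (z : L) (i : Fin m) : xb.repr z i = killingForm ℂ L (yb xb i) z := by
  conv_rhs => rw [← xb.sum_repr z]
  simp only [map_sum, map_smul, killing_yb, smul_eq_mul, mul_ite, mul_one, mul_zero]
  simp

variable (V) in
/-- Casimir operator -/
noncomputable def cas : End ℂ V := ∑ i, toEnd ℂ L V (xb i) * toEnd ℂ L V (yb xb i)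

lemma cas_comm (z : L) (v : V) : cas V xb ⁅z, v⁆ = ⁅z, cas V xb v⁆ := by
  have h1 : ∀ i, ⁅z, xb i⁆ = ∑ j, killingForm ℂ L (yb xb j) ⁅z, xb i⁆ • xb j := fun i => by
    conv_lhs => rw [← xb.sum_repr ⁅z, xb i⁆]
    simp only [xb_repr]
  have h2 : ∀ i, ⁅z, yb xb i⁆ = - ∑ j, killingForm ℂ L (yb xb i) ⁅z, xb j⁆ • yb xb j := fun i => by
    conv_lhs => rw [← (yb xb).sum_repr ⁅z, yb xb i⁆]
    rw [← Finset.sum_neg_distrib]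
    refine Finset.sum_congr rfl fun j _ => ?_
    rw [yb_repr, ← neg_smul]
    congr 1
    rw [← lie_skew, map_neg, LinearMap.neg_apply]
    congr 1
    exact traceForm_apply_lie_apply ℂ L L _ _ _
  have h3 : ⁅z, cas V xb v⁆ - cas V xb ⁅z, v⁆ =
      ∑ i, (⁅⁅z, xb i⁆, ⁅yb xb i, v⁆⁆ + ⁅xb i, ⁅⁅z, yb xb i⁆, v⁆⁆) := by
    simp only [cas, LinearMap.sum_apply, Module.End.mul_apply, toEnd_apply_apply, lie_sum]
    rw [← Finset.sum_sub_distrib]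
    refine Finset.sum_congr rfl fun i _ => ?_
    simp only [lie_lie, lie_sub]
    abel
  have h4 : ∀ i, ⁅⁅z, xb i⁆, ⁅yb xb i, v⁆⁆ = ∑ j, killingForm ℂ L (yb xb j) ⁅z, xb i⁆ • ⁅xb j, ⁅yb xb i, v⁆⁆ := fun i => by
    conv_lhs => rw [h1 i]
    simp only [sum_lie, smul_lie]
  have h5 : ∀ i, ⁅xb i, ⁅⁅z, yb xb i⁆, v⁆⁆ = - ∑ j, killingForm ℂ L (yb xb i) ⁅z, xb j⁆ • ⁅xb i, ⁅yb xb j, v⁆⁆ := fun i => by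
    rw [h2 i]
    simp only [sum_lie, smul_lie, lie_sum, lie_smul, neg_lie, lie_neg]
  rw [eq_comm, ← sub_eq_zero, h3, Finset.sum_add_distrib]
  simp only [h4, h5]
  rw [Finset.sum_comm, ← Finset.sum_add_distrib]
  refine Finset.sum_eq_zero fun i _ => add_neg_cancel _

lemma cas_scalar [FiniteDimensional ℂ V] [LieModule.IsIrreducible ℂ L V] : ∃ c : ℂ, cas V xb = c • 1 := by
  have := irr_nontrivial (L := L) (V := V)
  obtain ⟨c, hc⟩ := Module.End.exists_eigenvalue (cas V xb)
  obtain ⟨v, hv⟩ := hc.exists_hasEigenvector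
  refine ⟨c, ?_⟩
  have h := irr_top (L := L) (Module.End.eigenspace (cas V xb) c) (fun x w hw => by
    rw [Module.End.mem_eigenspace_iff] at hw ⊢
    rw [cas_comm, hw, lie_smul]) v hv.1 hv.2
  ext w
  have : w ∈ Module.End.eigenspace (cas V xb) c := by rw [h]; trivial
  rw [Module.End.mem_eigenspace_iff] at this
  rw [this]; rfl

variable {xb} {xw : Fin m → Dual ℂ H} (hx : IsWB H xb xw)
include hx

lemma yb_WS (i : Fin m) : yb xb i ∈ WS H L (- xw i) := by
  intro h
  apply (yb xb).repr.injective
  ext j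
  rw [yb_repr, map_smul, Finsupp.smul_apply, yb_repr, ← lie_skew, map_neg, LinearMap.neg_apply]
  have : killingForm ℂ L ⁅yb xb i, (h : L)⁆ (xb j) = killingForm ℂ L (yb xb i) ⁅(h : L), xb j⁆ :=
    traceForm_apply_lie_apply ℂ L L _ _ _
  rw [this, hx j h, map_smul, killing_yb]
  split_ifs with e
  · rw [e]; simp
  · simp

lemma lie_xy (i : Fin m) (hi : xw i ≠ 0) : ⁅xb i, yb xb i⁆ = (tt H (xw i) : H) := by
  obtain ⟨γ, hγ⟩ := root_of_WS H hi (hx i) (xb.ne_zero i)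
  have h1 : xb i ∈ rootSpace H γ.1 := by
    have := hx i
    rw [← hγ, ← WS_eq] at this
    exact this
  have h2 : yb xb i ∈ rootSpace H (-γ.1) := by
    have := yb_WS hx i
    have e : - xw i = (-γ.1).toLinear := by rw [← hγ]; ext; simp
    rw [e, ← WS_eq] at this
    exact this
  rw [lie_eq_killingForm_smul_of_mem_rootSpace_of_mem_rootSpace_neg h1 h2]
  have h3 : killingForm ℂ L (xb i) (yb xb i) = 1 := by
    rw [traceForm_comm, killing_yb, if_pos rfl]
  rw [h3, one_smul, tt, hγ]

open Classical in
lemma card_root (γ : H.root) : (Finset.univ.filter fun i => xw i = γ.1.toLinear).card = 1 := by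
  rw [← hx.finrank_WS, ← WS_eq]
  exact finrank_rootSpace_eq_one γ.1 (isNonZero γ)

end Cas
end
end UF

namespace UF
open LieAlgebra LieAlgebra.IsKilling LieModule Module

set_option linter.unusedSectionVars false
section
variable {L : Type*} [LieRing L] [LieAlgebra ℂ L] [FiniteDimensional ℂ L] [IsKilling ℂ L]
  {H : LieSubalgebra ℂ L} [H.IsCartanSubalgebra]
  {V : Type*} [AddCommGroup V] [Module ℂ V] [LieRingModule L V] [LieModule ℂ L V]
  [FiniteDimensional ℂ V]

lemma mem_pos (b : (rootSystem H).Base) {x : Dual ℂ H} :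
    x ∈ (rd b).pos ↔ ∃ γ : H.root, b.IsPos γ ∧ γ.1.toLinear = x := by
  classical
  simp [rd]

lemma root_inj {γ δ : H.root} (h : γ.1.toLinear = δ.1.toLinear) : γ = δ :=
  (rootSystem H).root.injective h

lemma self_neg_zero {x : Dual ℂ H} (h : x = -x) : x = 0 := by
  ext y
  have := LinearMap.congr_fun h y
  rw [LinearMap.neg_apply] at this
  exact self_eq_neg.1 this

lemma exists_neg (b : (rootSystem H).Base) (γ : H.root) : ∃ δ : H.root,
    δ.1.toLinear = - γ.1.toLinear ∧ (b.IsPos δ ↔ ¬ b.IsPos γ) := by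
  let := (rootSystem H).indexNeg
  refine ⟨-γ, ?_, RootPairing.Base.IsPos.neg_iff_not b γ⟩
  have := (rootSystem H).root_reflectionPerm γ γ
  rw [RootPairing.reflection_apply_self] at this
  exact this

lemma pos_ne_zero (b : (rootSystem H).Base) {x : Dual ℂ H} (hx : x ∈ (rd b).pos) : x ≠ 0 := by
  obtain ⟨γ, -, rfl⟩ := (mem_pos b).1 hx
  exact (rootSystem H).ne_zero γ

section
variable {I : Type*} [Fintype I] {bas : Basis I ℂ V} {wt : I → Dual ℂ H} (hb : IsWB H bas wt)
  (b : (rootSystem H).Base)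
  {m : ℕ} {xb : Basis (Fin m) ℂ L} {xw : Fin m → Dual ℂ H} (hx : IsWB H xb xw)
include hb hx

lemma fm_term (i : Fin m) (hi : xw i ≠ 0) :
    RD.fm (xw i) * gtr bas wt (toEnd ℂ L V (xb i) * toEnd ℂ L V (yb xb i)) =
      ee ((2⁻¹ : ℂ) • xw i) * (rd b).pd (xw i) (chr H wt) := by
  have h1 := gtr_comm hb (hx i) (toEnd ℂ L V (yb xb i))
  have h2 : gtr bas wt (toEnd ℂ L V (xb i) * toEnd ℂ L V (yb xb i)) -
      gtr bas wt (toEnd ℂ L V (yb xb i) * toEnd ℂ L V (xb i)) = (rd b).pd (xw i) (chr H wt) := by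
    rw [← map_sub, toEnd_br, lie_xy hx i hi, gtr_H hb b]
  rw [← h2, RD.fm, sub_mul, mul_sub]
  congr 1
  rw [h1, ← mul_assoc, ← ee_add]
  congr 2
  module

open Classical in
lemma sum_zero : ∑ i, (if xw i = 0 then
    gtr bas wt (toEnd ℂ L V (xb i) * toEnd ℂ L V (yb xb i)) else 0) = (rd b).lap (chr H wt) := by
  have h0 : ∀ i, xw i = 0 → xb i ∈ H ∧ yb xb i ∈ H := fun i hi =>
    ⟨mem_H_of_WS H (hi ▸ hx i), mem_H_of_WS H (by simpa [hi] using yb_WS hx i)⟩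
  have key : ∀ μ : Dual ℂ H, ∀ v ∈ WS H V μ,
      ∑ i, (if xw i = 0 then ⁅xb i, ⁅yb xb i, v⁆⁆ else 0) = μ (tt H μ) • v := by
    intro μ v hv
    rw [← hv (tt H μ)]
    conv_rhs => rw [← (yb xb).sum_repr (tt H μ : L), sum_lie]
    refine Finset.sum_congr rfl fun i _ => ?_
    rw [yb_repr, smul_lie]
    split_ifs with hi
    · obtain ⟨h1, h2⟩ := h0 i hi
      rw [killing_tt H μ ⟨xb i, h1⟩, hv ⟨_, h2⟩, lie_smul, hv ⟨_, h1⟩, smul_comm]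
    · have hz : killingForm ℂ L (tt H μ : L) (xb i) = 0 := by
        obtain ⟨h, hh⟩ : ∃ h : H, xw i h ≠ 0 := by
          by_contra hc
          push Not at hc
          exact hi (LinearMap.ext hc)
        have e : killingForm ℂ L ⁅(tt H μ : L), (h : L)⁆ (xb i) =
          killingForm ℂ L (tt H μ : L) ⁅(h : L), xb i⁆ := traceForm_apply_lie_apply ℂ L L _ _ _
        have e2 : ⁅(tt H μ : L), (h : L)⁆ = 0 := by
          rw [← LieSubalgebra.coe_bracket, trivial_lie_zero]; rfl
        rw [e2, hx i h, map_smul, map_zero, LinearMap.zero_apply] at e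
        exact (smul_eq_zero.1 e.symm).resolve_left hh
      rw [hz, zero_smul]
  rw [RD.lap, chr, map_sum]
  simp only [mulc_ee, gtr_apply]
  have : ∀ i : Fin m, (if xw i = 0 then ∑ j, bas.repr ((toEnd ℂ L V (xb i) * toEnd ℂ L V (yb xb i)) (bas j)) j • ee (wt j) else 0) =
     ∑ j, bas.repr (if xw i = 0 then ⁅xb i, ⁅yb xb i, bas j⁆⁆ else 0) j • ee (wt j) := fun i => by
    split_ifs <;> simp
  simp only [this]
  rw [Finset.sum_comm]
  refine Finset.sum_congr rfl fun j _ => ?_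
  rw [← Finset.sum_smul]
  congr 1
  have := congrArg (fun v => bas.repr v j) (key _ _ (hb j))
  simp only [map_sum, Finsupp.finsetSum_apply] at this
  rw [this]
  simp [rd, BF_apply]

open Classical in
lemma sum_filter_root (γ : H.root) :
    RD.fm γ.1.toLinear * ∑ i, (if xw i = γ.1.toLinear then
      gtr bas wt (toEnd ℂ L V (xb i) * toEnd ℂ L V (yb xb i)) else 0) =
      ee ((2⁻¹ : ℂ) • γ.1.toLinear) * (rd b).pd γ.1.toLinear (chr H wt) := by
  obtain ⟨i, hi⟩ := Finset.card_eq_one.1 (card_root hx γ)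
  have hi' : xw i = γ.1.toLinear := by
    have : i ∈ Finset.univ.filter fun i => xw i = γ.1.toLinear := by rw [hi]; simp
    simpa using this
  rw [← Finset.sum_filter]
  have := fm_term hb b hx i (by rw [hi']; exact (rootSystem H).ne_zero γ)
  rw [hi'] at this
  rw [← this]
  congr 1
  convert Finset.sum_singleton _ i using 2

end

lemma fm_neg (x : Dual ℂ H) : RD.fm (-x) = - RD.fm x := by
  simp [RD.fm]

variable [LieModule.IsIrreducible ℂ L V]

lemma freud_chr {I : Type*} [Fintype I] {bas : Basis I ℂ V} {wt : I → Dual ℂ H}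
    (hb : IsWB H bas wt) (b : (rootSystem H).Base) :
    ∃ (c : ℂ) (G : Dual ℂ H → GA (Dual ℂ H)), c • chr H wt = (rd b).lap (chr H wt) +
      ∑ x ∈ (rd b).pos, G x ∧
    ∀ x ∈ (rd b).pos, RD.fm x * G x = RD.fp x * (rd b).pd x (chr H wt) := by
  classical
  obtain ⟨m, xb, xw, hx⟩ := exists_WB (H := H) (span_WS_L H)
  obtain ⟨c, hc⟩ := cas_scalar (V := V) xb
  let T : Fin m → GA (Dual ℂ H) := fun i =>
    gtr bas wt (toEnd ℂ L V (xb i) * toEnd ℂ L V (yb xb i))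
  refine ⟨c, fun x => (∑ i, if xw i = x then T i else 0) + ∑ i, if xw i = -x then T i else 0, ?_, ?_⟩
  · have h1 : c • chr H wt = ∑ i, T i := by
      rw [← gtr_one (bas := bas), ← map_smul, ← hc, cas, map_sum]
    rw [h1, ← sum_zero hb b hx]
    simp only [← Finset.sum_add_distrib]
    rw [Finset.sum_comm, ← Finset.sum_add_distrib]
    refine Finset.sum_congr rfl fun i _ => ?_
    by_cases hi : xw i = 0
    · rw [if_pos hi, Finset.sum_eq_zero, add_zero]
      intro x hxp
      have := pos_ne_zero b hxp
      rw [if_neg, if_neg, add_zero]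
      · rw [hi]; intro h; exact this (by simpa using h.symm)
      · rw [hi]; exact this.symm
    · rw [if_neg hi, zero_add]
      obtain ⟨γ, hγ⟩ := root_of_WS H hi (hx i) (xb.ne_zero i)
      obtain ⟨δ, hδ, hδ'⟩ := exists_neg b γ
      by_cases hp : b.IsPos γ
      · rw [Finset.sum_eq_single (xw i)]
        · rw [if_pos rfl, if_neg, add_zero]
          intro h
          exact hi (self_neg_zero h)
        · intro x hxp hne
          rw [if_neg hne.symm, if_neg, add_zero]
          intro h
          obtain ⟨ε, hε, hε'⟩ := (mem_pos b).1 hxp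
          have : ε = δ := root_inj (by rw [hε', hδ, hγ, h, neg_neg])
          rw [this] at hε
          exact hδ'.1 hε hp
        · intro h
          exact absurd ((mem_pos b).2 ⟨γ, hp, hγ⟩) h
      · rw [Finset.sum_eq_single (-xw i)]
        · rw [if_pos (neg_neg _).symm, if_neg, zero_add]
          intro h
          exact hi (self_neg_zero h)
        · intro x hxp hne
          rw [if_neg, if_neg, add_zero]
          · intro h
            exact hne (by rw [h, neg_neg])
          · intro h
            obtain ⟨ε, hε, hε'⟩ := (mem_pos b).1 hxp
            have : ε = γ := root_inj (by rw [hε', hγ, h])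
            rw [this] at hε
            exact hp hε
        · intro h
          exact absurd ((mem_pos b).2 ⟨δ, hδ'.2 hp, by rw [hδ, hγ]⟩) h
  · intro x hxp
    obtain ⟨γ, hγ, rfl⟩ := (mem_pos b).1 hxp
    obtain ⟨δ, hδ, -⟩ := exists_neg b γ
    have h1 := sum_filter_root hb b hx γ
    have h2 := sum_filter_root hb b hx δ
    rw [hδ, fm_neg, RD.pd_neg, smul_neg] at h2
    rw [mul_add, h1, RD.fp, add_mul]
    congr 1
    rw [← neg_inj, ← neg_mul, h2, mul_neg]

lemma inv_chr {I : Type*} [Fintype I] {bas : Basis I ℂ V} {wt : I → Dual ℂ H}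
    (hb : IsWB H bas wt) (b : (rootSystem H).Base) (i : b.support) :
    (rd b).sg i (chr H wt) = chr H wt := by
  ext μ
  have h1 := (rd b).coeff_sg i (chr H wt) ((rd b).s i μ)
  rw [(rd b).s_s] at h1
  rw [h1, hb.coeff_chr, hb.coeff_chr]
  congr 1
  exact refl_eq (V := V) (i : H.root) μ
end
end UF

namespace UF
open LieAlgebra LieAlgebra.IsKilling LieModule Module

set_option linter.unusedSectionVars false
section
variable {L : Type*} [LieRing L] [LieAlgebra ℂ L] [FiniteDimensional ℂ L] [IsKilling ℂ L]
  {H : LieSubalgebra ℂ L} [H.IsCartanSubalgebra] (b : (rootSystem H).Base)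
  {V : Type*} [AddCommGroup V] [Module ℂ V] [LieRingModule L V] [LieModule ℂ L V]

lemma tri {γ : Dual ℂ H} {x : L} (hx : x ∈ WS H L γ) (h0 : x ≠ 0) :
    γ = 0 ∨ ∃ d : b.support →₀ ℕ, d ≠ 0 ∧ (γ = (rd b).q d ∨ γ = - (rd b).q d) := by
  by_cases hγ : γ = 0
  · exact Or.inl hγ
  right
  obtain ⟨δ, hδ⟩ := root_of_WS H hγ hx h0
  by_cases hp : b.IsPos δ
  · obtain ⟨d, hd, e⟩ := (rd b).pos_mem γ ((mem_pos b).2 ⟨δ, hp, hδ⟩)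
    exact ⟨d, hd, Or.inl e⟩
  · obtain ⟨ε, hε, hε'⟩ := exists_neg b δ
    obtain ⟨d, hd, e⟩ := (rd b).pos_mem (-γ) ((mem_pos b).2 ⟨ε, hε'.2 hp, by rw [hε, hδ]⟩)
    exact ⟨d, hd, Or.inr (by rw [RD.q_apply, ← e, neg_neg])⟩

/-- primitive vectors -/
def Prim (v : V) : Prop := ∀ d : b.support →₀ ℕ, d ≠ 0 → ∀ x ∈ WS H L ((rd b).q d), ⁅x, v⁆ = 0

/-- iterated descendants of a vector -/
inductive Des (v : V) : V → (b.support →₀ ℕ) → Prop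
  | base : Des v v 0
  | step {u : V} {c d : b.support →₀ ℕ} {f : L} (hu : Des v u c) (hd : d ≠ 0)
      (hf : f ∈ WS H L (-(rd b).q d)) : Des v ⁅f, u⁆ (c + d)

/-- the span of the descendants -/
def gen (v : V) : Submodule ℂ V := Submodule.span ℂ {u | ∃ c, Des b v u c}

lemma mem_gen (v : V) : v ∈ gen b v := Submodule.subset_span ⟨0, Des.base⟩

variable {b}

lemma Des.zero {v u : V} {c : b.support →₀ ℕ} (h : Des b v u c) (hc : c = 0) : u = v := by
  induction h with
  | base => rfl
  | @step u c d f hu hd hf ih => exact absurd (add_eq_zero.1 hc).2 hd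

lemma Des.ws {v u : V} {c : b.support →₀ ℕ} (h : Des b v u c) {lam : Dual ℂ H}
    (hv : v ∈ WS H V lam) : u ∈ WS H V (lam - (rd b).q c) := by
  induction h with
  | base => simpa using hv
  | @step u c d f hu hd hf ih =>
    have := lie_WS hf ih
    convert this using 1
    rw [map_add, sub_add_eq_sub_sub, sub_eq_neg_add]

lemma gen_lower {v u : V} (hu : u ∈ gen b v) {d : b.support →₀ ℕ} (hd : d ≠ 0) {f : L}
    (hf : f ∈ WS H L (-(rd b).q d)) : ⁅f, u⁆ ∈ gen b v := by
  induction hu using Submodule.span_induction with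
  | mem x h =>
    obtain ⟨c, h⟩ := h
    exact Submodule.subset_span ⟨_, h.step hd hf⟩
  | zero => simp
  | add x y _ _ hx hy => rw [lie_add]; exact add_mem hx hy
  | smul c x _ hx => rw [lie_smul]; exact Submodule.smul_mem _ _ hx

lemma Des.stable {v u : V} {c : b.support →₀ ℕ} (h : Des b v u c) {lam : Dual ℂ H}
    (hv : v ∈ WS H V lam) (hp : Prim b v) (γ : Dual ℂ H) (x : L) (hx : x ∈ WS H L γ) :
    ⁅x, u⁆ ∈ gen b v := by
  induction h generalizing γ x with
  | base =>
    by_cases h0 : x = 0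
    · simp [h0]
    obtain rfl | ⟨d, hd, rfl | rfl⟩ := tri b hx h0
    · rw [hv ⟨x, mem_H_of_WS H hx⟩]
      exact Submodule.smul_mem _ _ (mem_gen b v)
    · rw [hp d hd x hx]; exact zero_mem _
    · exact gen_lower (mem_gen b v) hd hx
  | @step u c d f hu hd hf ih =>
    by_cases h0 : x = 0
    · simp [h0]
    obtain rfl | ⟨d', hd', rfl | rfl⟩ := tri b hx h0
    · rw [(hu.step hd hf).ws hv ⟨x, mem_H_of_WS H hx⟩]
      exact Submodule.smul_mem _ _ (Submodule.subset_span ⟨_, hu.step hd hf⟩)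
    · rw [leibniz_lie]
      exact add_mem (ih _ _ (lie_WS hx hf)) (gen_lower (ih _ _ hx) hd hf)
    · exact gen_lower (Submodule.subset_span ⟨_, hu.step hd hf⟩) hd' hx

lemma gen_stable {v : V} {lam : Dual ℂ H}
    (hv : v ∈ WS H V lam) (hp : Prim b v) (x : L) (u : V) (hu : u ∈ gen b v) : ⁅x, u⁆ ∈ gen b v := by
  induction hu using Submodule.span_induction with
  | mem u h =>
    obtain ⟨c, h⟩ := h
    exact lie_mem_of_WS H (fun γ x hx => h.stable hv hp γ x hx) x
  | zero => simp
  | add x y _ _ hx hy => rw [lie_add]; exact add_mem hx hy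
  | smul c x _ hx => rw [lie_smul]; exact Submodule.smul_mem _ _ hx

section
variable {I : Type*} [Fintype I] {bas : Basis I ℂ V} {wt : I → Dual ℂ H} (hb : IsWB H bas wt)
include hb

lemma gen_WS {v : V} {lam : Dual ℂ H} (hv : v ∈ WS H V lam) {w : V} (hw : w ∈ gen b v)
    (hw' : w ∈ WS H V lam) : ∃ c : ℂ, w = c • v := by
  classical
  have key : ∀ u ∈ gen b v, ∃ c : ℂ, ∀ i, wt i = lam → bas.repr u i = c * bas.repr v i := by
    intro u hu
    induction hu using Submodule.span_induction with
    | mem u h =>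
      obtain ⟨c, h⟩ := h
      by_cases hc : c = 0
      · exact ⟨1, fun i _ => by rw [h.zero hc, one_mul]⟩
      · refine ⟨0, fun i hi => ?_⟩
        rw [zero_mul]
        refine (hb.mem_iff _ _).1 (h.ws hv) i fun e => hc ?_
        rw [hi, eq_comm, sub_eq_self] at e
        exact (rd b).q_inj (by rw [e, map_zero])
    | zero => exact ⟨0, by simp⟩
    | add x y _ _ hx hy =>
      obtain ⟨c, hc⟩ := hx
      obtain ⟨c', hc'⟩ := hy
      exact ⟨c + c', fun i hi => by rw [map_add, Finsupp.add_apply, hc i hi, hc' i hi, add_mul]⟩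
    | smul a x _ hx =>
      obtain ⟨c, hc⟩ := hx
      exact ⟨a * c, fun i hi => by rw [map_smul, Finsupp.smul_apply, hc i hi, smul_eq_mul, mul_assoc]⟩
  obtain ⟨c, hc⟩ := key w hw
  refine ⟨c, bas.repr.injective ?_⟩
  ext i
  rw [map_smul, Finsupp.smul_apply, smul_eq_mul]
  by_cases hi : wt i = lam
  · exact hc i hi
  · rw [(hb.mem_iff _ _).1 hw' i hi, (hb.mem_iff _ _).1 hv i hi, mul_zero]

lemma exists_wt {v : V} {lam : Dual ℂ H} (hv : v ∈ WS H V lam) (hg : gen b v = ⊤) (i : I) :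
    ∃ c, wt i = lam - (rd b).q c := by
  by_contra hcon
  push Not at hcon
  have key : ∀ u ∈ gen b v, bas.repr u i = 0 := by
    intro u hu
    induction hu using Submodule.span_induction with
    | mem u h =>
      obtain ⟨c, h⟩ := h
      exact (hb.mem_iff _ _).1 (h.ws hv) i (hcon c)
    | zero => simp
    | add x y _ _ hx hy => rw [map_add, Finsupp.add_apply, hx, hy, add_zero]
    | smul a x _ hx => rw [map_smul, Finsupp.smul_apply, hx, smul_zero]
  have := key (bas i) (by rw [hg]; trivial)
  simp at this

lemma top_chr {v : V} {lam : Dual ℂ H} (hv : v ∈ WS H V lam) (h0 : v ≠ 0) (hg : gen b v = ⊤) :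
    ∃ p, (rd b).Top (chr H wt) lam p := by
  classical
  choose c hc using exists_wt hb hv hg
  refine ⟨∑ i, MvPolynomial.monomial (c i) 1, ?_, ?_⟩
  · rw [map_sum, chr, Finset.mul_sum]
    refine Finset.sum_congr rfl fun i _ => ?_
    rw [RD.Φ_monomial, ← ee_add, hc, sub_eq_add_neg]
  · rw [MvPolynomial.coeff_sum]
    simp only [MvPolynomial.coeff_monomial]
    rw [Finset.sum_boole]
    have h1 : (Finset.univ.filter fun i => c i = 0) = Finset.univ.filter fun i => wt i = lam := by
      ext i
      simp only [Finset.mem_filter, Finset.mem_univ, true_and]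
      rw [hc i, sub_eq_self]
      exact ⟨fun e => by rw [e, map_zero], fun e => (rd b).q_inj (by rw [e, map_zero])⟩
    rw [h1]
    have h2 : finrank ℂ (WS H V lam) = 1 := by
      rw [finrank_eq_one_iff']
      refine ⟨⟨v, hv⟩, fun e => h0 (congrArg Subtype.val e), fun w => ?_⟩
      obtain ⟨a, ha⟩ := gen_WS hb hv (by rw [hg]; trivial) w.2
      exact ⟨a, Subtype.ext ha.symm⟩
    rw [hb.finrank_WS] at h2
    rw [Nat.cast_eq_one]
    convert h2

end

variable [FiniteDimensional ℂ V] [LieModule.IsIrreducible ℂ L V]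

lemma gen_top {v : V} {lam : Dual ℂ H} (hv : v ∈ WS H V lam) (h0 : v ≠ 0) (hp : Prim b v) :
    gen b v = ⊤ :=
  irr_top (L := L) _ (gen_stable hv hp) v (mem_gen b v) h0

variable (b V)

lemma exists_height : ∃ ht : Dual ℂ H →ₗ[ℂ] ℂ, ∀ i : b.support, ht ((rd b).α i) = 1 := by
  let B := Basis.extend (rd b).li.linearIndepOn_id
  refine ⟨B.constr ℂ fun _ => (1 : ℂ), fun i => ?_⟩
  have hm : (rd b).α i ∈ (rd b).li.linearIndepOn_id.extend (Set.subset_univ _) :=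
    (rd b).li.linearIndepOn_id.subset_extend _ ⟨i, rfl⟩
  have : B ⟨_, hm⟩ = (rd b).α i := Basis.extend_apply_self _ _
  rw [← this, Basis.constr_basis]

lemma exists_hw : ∃ (lam : Dual ℂ H) (v : V), v ≠ 0 ∧ v ∈ WS H V lam ∧ Prim b v := by
  have := irr_nontrivial (L := L) (V := V)
  obtain ⟨m, bas, wt, hb⟩ := exists_WB (H := H) (V := V) (span_WS_irr H)
  obtain ⟨ht, hht⟩ := exists_height b
  have : Nonempty (Fin m) := bas.index_nonempty
  obtain ⟨i, hi⟩ := Finite.exists_max fun i => (ht (wt i)).re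
  refine ⟨wt i, bas i, bas.ne_zero i, hb i, fun d hd x hx => ?_⟩
  have h1 := lie_WS hx (hb i)
  have hq : 0 < (ht ((rd b).q d)).re := by
    have : ht ((rd b).q d) = ((∑ j, d j : ℕ) : ℂ) := by
      simp [RD.q_apply, hht]
    rw [this, Complex.natCast_re, Nat.cast_pos]
    obtain ⟨j, hj⟩ := Finsupp.ne_iff.1 hd
    exact Finset.sum_pos' (fun _ _ => Nat.zero_le _) ⟨j, Finset.mem_univ _, Nat.pos_of_ne_zero hj⟩
  apply bas.repr.injective
  ext j
  rw [map_zero, Finsupp.zero_apply]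
  refine (hb.mem_iff _ _).1 h1 j fun e => ?_
  have := hi j
  rw [e, map_add, Complex.add_re] at this
  linarith

variable {V}

lemma exists_l {lam : Dual ℂ H} {v : V} (h0 : v ≠ 0) (hv : v ∈ WS H V lam) (hp : Prim b v)
    (i : b.support) : ∃ n : ℕ, lam (coroot (i : H.root).1) = n := by
  obtain ⟨e, f, he, hf, ht, -, -⟩ := exists_sl2 (i : H.root)
  have P : ht.HasPrimitiveVectorWith v (lam (coroot (i : H.root).1)) :=
    { ne_zero := h0
      lie_h := hv _
      lie_e := by
        obtain ⟨d, hd, e'⟩ := (rd b).pos_mem _ ((rd b).simple_mem i)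
        refine hp d hd e ?_
        rw [RD.q_apply, ← e']
        exact he }
  exact P.exists_nat

lemma lam_ext {lam lam' : Dual ℂ H} (h : ∀ i : b.support, lam (coroot (i : H.root).1) =
    lam' (coroot (i : H.root).1)) : lam = lam' := by
  refine b.toCoweightBasis.ext fun i => ?_
  rw [b.toCoweightBasis_apply]
  exact h i

end

section Prod
variable {L : Type*} [LieRing L] [LieAlgebra ℂ L]
  (V : Type*) [AddCommGroup V] [Module ℂ V] [LieRingModule L V] [LieModule ℂ L V]
  (W : Type*) [AddCommGroup W] [Module ℂ W] [LieRingModule L W] [LieModule ℂ L W]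

/-- product of modules -/
@[reducible] def prodLRM : LieRingModule L (V × W) where
  bracket x p := (⁅x, p.1⁆, ⁅x, p.2⁆)
  add_lie x y p := by ext <;> exact add_lie _ _ _
  lie_add x p q := by ext <;> exact lie_add _ _ _
  leibniz_lie x y p := by ext <;> exact leibniz_lie _ _ _

attribute [local instance] prodLRM

lemma prod_lie (x : L) (p : V × W) : ⁅x, p⁆ = (⁅x, p.1⁆, ⁅x, p.2⁆) := rfl

lemma prodLM : LieModule ℂ L (V × W) where
  smul_lie c x p := by ext <;> exact smul_lie _ _ _
  lie_smul c x p := by ext <;> exact lie_smul _ _ _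

attribute [local instance] prodLM

variable [FiniteDimensional ℂ L] [IsKilling ℂ L]
  {H : LieSubalgebra ℂ L} [H.IsCartanSubalgebra] (b : (rootSystem H).Base)
  [FiniteDimensional ℂ V] [LieModule.IsIrreducible ℂ L V]
  [FiniteDimensional ℂ W] [LieModule.IsIrreducible ℂ L W]
variable {V W}

lemma iso_of_hw {lam : Dual ℂ H} {v : V} (h0 : v ≠ 0) (hv : v ∈ WS H V lam) (hp : Prim b v)
    {w : W} (h0' : w ≠ 0) (hw : w ∈ WS H W lam) (hp' : Prim b w) : Nonempty (V ≃ₗ⁅ℂ,L⁆ W) := by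
  have h1 : (v, w) ∈ WS H (V × W) lam := fun h => by
    rw [prod_lie, hv h, hw h]; rfl
  have h2 : Prim b (v, w) := fun d hd x hx => by
    rw [prod_lie, hp d hd x hx, hp' d hd x hx]; rfl
  let U := gen b (v, w)
  have hU := gen_stable h1 h2
  obtain ⟨m, bas, wt, hb⟩ := exists_WB (H := H) (V := V) (span_WS_irr H)
  obtain ⟨m', bas', wt', hb'⟩ := exists_WB (H := H) (V := W) (span_WS_irr H)
  have hB : IsWB H (bas.prod bas') (Sum.elim wt wt') := by
    rintro (i | i) h
    · rw [prod_lie]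
      ext <;> simp [hb i h]
    · rw [prod_lie]
      ext <;> simp [hb' i h]
  have key : ∀ z ∈ U, z ∈ WS H (V × W) lam → ∃ c : ℂ, z = c • (v, w) := fun z hz hz' =>
    gen_WS hB h1 hz hz'
  have s1 : U.map (LinearMap.fst ℂ V W) = ⊤ := irr_top (L := L) _ (by
    rintro x _ ⟨z, hz, rfl⟩
    exact ⟨⁅x, z⁆, hU x z hz, rfl⟩) v ⟨_, mem_gen b _, rfl⟩ h0
  have s2 : U.map (LinearMap.snd ℂ V W) = ⊤ := irr_top (L := L) _ (by
    rintro x _ ⟨z, hz, rfl⟩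
    exact ⟨⁅x, z⁆, hU x z hz, rfl⟩) w ⟨_, mem_gen b _, rfl⟩ h0'
  have i1 : ∀ y, ((0 : V), y) ∈ U → y = 0 := by
    intro y hy
    by_contra hne
    have := irr_top (L := L) (U.comap (LinearMap.inr ℂ V W)) (by
      intro x y hy
      have := hU x _ hy
      rw [prod_lie] at this
      simpa using this) y hy hne
    have hw' : w ∈ U.comap (LinearMap.inr ℂ V W) := by rw [this]; trivial
    obtain ⟨c, hc⟩ := key _ hw' (fun h => by
      rw [prod_lie]; ext <;> simp [hw h])
    have e1 := congrArg Prod.fst hc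
    have e2 := congrArg Prod.snd hc
    simp only [Prod.smul_mk, LinearMap.inr_apply, LinearMap.inl_apply] at e1 e2
    rcases smul_eq_zero.1 e1.symm with e1 | e1
    · rw [e1, zero_smul] at e2; exact h0' e2
    · exact h0 e1
  have i2 : ∀ y, (y, (0 : W)) ∈ U → y = 0 := by
    intro y hy
    by_contra hne
    have := irr_top (L := L) (U.comap (LinearMap.inl ℂ V W)) (by
      intro x y hy
      have := hU x _ hy
      rw [prod_lie] at this
      simpa using this) y hy hne
    have hw' : v ∈ U.comap (LinearMap.inl ℂ V W) := by rw [this]; trivial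
    obtain ⟨c, hc⟩ := key _ hw' (fun h => by
      rw [prod_lie]; ext <;> simp [hv h])
    have e1 := congrArg Prod.fst hc
    have e2 := congrArg Prod.snd hc
    simp only [Prod.smul_mk, LinearMap.inr_apply, LinearMap.inl_apply] at e1 e2
    rcases smul_eq_zero.1 e2.symm with e2 | e2
    · rw [e2, zero_smul] at e1; exact h0 e1
    · exact h0' e2
  let E1 : U ≃ₗ[ℂ] V := LinearEquiv.ofBijective ((LinearMap.fst ℂ V W).comp U.subtype) (by
    constructor
    · rw [injective_iff_map_eq_zero]
      rintro ⟨⟨a, c⟩, hz⟩ h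
      have ha : a = 0 := h
      subst ha
      have := i1 c hz
      subst this
      rfl
    · intro a
      have : a ∈ U.map (LinearMap.fst ℂ V W) := by rw [s1]; trivial
      obtain ⟨z, hz, rfl⟩ := this
      exact ⟨⟨z, hz⟩, rfl⟩)
  let E2 : U ≃ₗ[ℂ] W := LinearEquiv.ofBijective ((LinearMap.snd ℂ V W).comp U.subtype) (by
    constructor
    · rw [injective_iff_map_eq_zero]
      rintro ⟨⟨a, c⟩, hz⟩ h
      have ha : c = 0 := h
      subst ha
      have := i2 a hz
      subst this
      rfl
    · intro a
      have : a ∈ U.map (LinearMap.snd ℂ V W) := by rw [s2]; trivial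
      obtain ⟨z, hz, rfl⟩ := this
      exact ⟨⟨z, hz⟩, rfl⟩)
  refine ⟨{ E1.symm.trans E2 with map_lie' := ?_ }⟩
  intro x a
  have hE1 : ∀ z : U, E1 z = z.1.1 := fun _ => rfl
  have hE2 : ∀ z : U, E2 z = z.1.2 := fun _ => rfl
  obtain ⟨z, rfl⟩ := E1.surjective a
  have : ⁅x, E1 z⁆ = E1 ⟨⁅x, z.1⁆, hU x _ z.2⟩ := rfl
  show E2 (E1.symm ⁅x, E1 z⁆) = ⁅x, E2 (E1.symm (E1 z))⁆
  rw [this, E1.symm_apply_apply, E1.symm_apply_apply]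
  rfl

end Prod
end UF

namespace UF
open LieAlgebra LieAlgebra.IsKilling LieModule Module

section
variable {L : Type*} [LieRing L] [LieAlgebra ℂ L] (H : LieSubalgebra ℂ L)

lemma tensorAll_WB (n : ℕ) (V : Fin n → LieModuleObj L) (m : Fin n → ℕ)
    (bas : ∀ j, Basis (Fin (m j)) ℂ (V j).carrier) (wt : ∀ j, Fin (m j) → Dual ℂ H)
    (hb : ∀ j, IsWB H (bas j) (wt j)) :
    ∃ (I : Type) (_ : Fintype I) (B : Basis I ℂ (LieModuleObj.tensorAll n V).carrier)
      (w : I → Dual ℂ H), IsWB H B w ∧ chr H w = ∏ j, chr H (wt j) := by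
  induction n with
  | zero =>
    refine ⟨Unit, inferInstance, Basis.singleton Unit ℂ, fun _ => 0, ?_, ?_⟩
    · intro i h
      rw [LinearMap.zero_apply, zero_smul]
      rfl
    · simp [chr, ee_zero]
  | succ n ih =>
    obtain ⟨I, hI, B, w, h1, h2⟩ := ih (fun i => V i.castSucc) (fun i => m i.castSucc)
      (fun i => bas i.castSucc) (fun i => wt i.castSucc) (fun i => hb i.castSucc)
    refine ⟨I × Fin (m (Fin.last n)), inferInstance, B.tensorProduct (bas (Fin.last n)),
      fun p => w p.1 + wt (Fin.last n) p.2, h1.tensor (hb (Fin.last n)), ?_⟩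
    rw [chr_tensor, h2, Fin.prod_univ_castSucc]

end
end UF

/-- **Unique factorization of tensor products (equal number of factors, trivial factors
allowed).**  Let `g` be a finite-dimensional simple complex Lie algebra, and let
`V 0, …, V (n-1)` and `W 0, …, W (n-1)` (`n ≥ 1`) be finite-dimensional irreducible
`g`-modules with `V 0 ⊗ ⋯ ⊗ V (n-1) ≅ W 0 ⊗ ⋯ ⊗ W (n-1)`.  Then there is a permutation
`σ` of `Fin n` with `V i ≅ W (σ i)` for all `i`. -/
theorem unique_factorization_tensor_product
    {L : Type} [LieRing L] [LieAlgebra ℂ L] [FiniteDimensional ℂ L] [LieAlgebra.IsSimple ℂ L]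
    (n : ℕ) (hn : 0 < n)
    (V W : Fin n → LieModuleObj L)
    (hVfd : ∀ i, FiniteDimensional ℂ (V i).carrier)
    (hWfd : ∀ j, FiniteDimensional ℂ (W j).carrier)
    (hVirr : ∀ i, LieModule.IsIrreducible ℂ L (V i).carrier)
    (hWirr : ∀ j, LieModule.IsIrreducible ℂ L (W j).carrier)
    (h : Nonempty ((LieModuleObj.tensorAll n V).carrier ≃ₗ⁅ℂ,L⁆
      (LieModuleObj.tensorAll n W).carrier)) :
    ∃ σ : Equiv.Perm (Fin n),
      ∀ i, Nonempty ((V i).carrier ≃ₗ⁅ℂ,L⁆ (W (σ i)).carrier) := by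
  classical
  obtain ⟨hK, H, hH, b, ⟨v0⟩⟩ := UF.exists_base L
  have := hVfd
  have := hWfd
  have := hVirr
  have := hWirr
  choose m bas wt hb using fun j => UF.exists_WB (H := H) (V := (V j).carrier) (UF.span_WS_irr H)
  choose m' bas' wt' hb' using fun j => UF.exists_WB (H := H) (V := (W j).carrier) (UF.span_WS_irr H)
  choose lam v hv0 hv hvp using fun j => UF.exists_hw b (V := (V j).carrier)
  choose lam' w hw0 hw hwp using fun j => UF.exists_hw b (V := (W j).carrier)
  choose l hl using fun j => UF.exists_l b (hv0 j) (hv j) (hvp j)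
  choose l' hl' using fun j => UF.exists_l b (hw0 j) (hw j) (hwp j)
  obtain ⟨I, _, B, u, hB, hu⟩ := UF.tensorAll_WB H n V m bas wt hb
  obtain ⟨I', _, B', u', hB', hu'⟩ := UF.tensorAll_WB H n W m' bas' wt' hb'
  have isoV : ∀ j k, l j = l k → Nonempty ((V j).carrier ≃ₗ⁅ℂ,L⁆ (V k).carrier) := fun j k e => by
    have e' : lam k = lam j := UF.lam_ext b fun i => by rw [hl, hl, e]
    exact UF.iso_of_hw b (hv0 j) (hv j) (hvp j) (hv0 k) (e' ▸ hv k) (hvp k)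
  have isoW : ∀ j k, l' j = l' k → Nonempty ((W j).carrier ≃ₗ⁅ℂ,L⁆ (W k).carrier) := fun j k e => by
    have e' : lam' k = lam' j := UF.lam_ext b fun i => by rw [hl', hl', e]
    exact UF.iso_of_hw b (hw0 j) (hw j) (hwp j) (hw0 k) (e' ▸ hw k) (hwp k)
  have isoVW : ∀ j k, l j = l' k → Nonempty ((V j).carrier ≃ₗ⁅ℂ,L⁆ (W k).carrier) := fun j k e => by
    have e' : lam' k = lam j := UF.lam_ext b fun i => by rw [hl, hl', e]
    exact UF.iso_of_hw b (hv0 j) (hv j) (hvp j) (hw0 k) (e' ▸ hw k) (hwp k)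
  obtain ⟨σ, hσ⟩ := (UF.rd b).unique_of_char v0 (UF.conn b v0)
    (fun j => UF.chr H (wt j)) (fun j => UF.chr H (wt' j)) l l'
    (fun j => ⟨by
      obtain ⟨p, hp⟩ := UF.top_chr (hb j) (hv j) (hv0 j) (UF.gen_top (hv j) (hv0 j) (hvp j))
      exact ⟨_, p, hp, fun i => hl j i⟩, UF.inv_chr (hb j) b, UF.freud_chr (hb j) b⟩)
    (fun j => ⟨by
      obtain ⟨p, hp⟩ := UF.top_chr (hb' j) (hw j) (hw0 j) (UF.gen_top (hw j) (hw0 j) (hwp j))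
      exact ⟨_, p, hp, fun i => hl' j i⟩, UF.inv_chr (hb' j) b, UF.freud_chr (hb' j) b⟩)
    (fun j k e => by obtain ⟨f⟩ := isoV j k e; exact (hb j).chr_eq (hb k) f)
    (fun j k e => by obtain ⟨f⟩ := isoW j k e; exact (hb' j).chr_eq (hb' k) f)
    (fun j k e => by obtain ⟨f⟩ := isoVW j k e; exact (hb j).chr_eq (hb' k) f)
    (by
      obtain ⟨f⟩ := h
      have := hB.chr_eq hB' f
      rw [hu, hu'] at this
      exact this)
  exact ⟨σ, fun i => isoVW i (σ i) (hσ i)⟩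
end

section
/- For every finite simple graph G with at least one vertex, the rational number c(G) is a nonnegative integer. -/
/-- An (ordered) `k`-partition of a finite simple graph `G`: an ordered `k`-tuple of nonempty,
pairwise disjoint independent sets of `G` whose union is the whole vertex set. -/
def SimpleGraph.IsOrderedPartition {V : Type*} [Fintype V] [DecidableEq V]
    (G : SimpleGraph V) {k : ℕ} (J : Fin k → Finset V) : Prop :=
  (∀ i, (J i).Nonempty) ∧ (∀ i j, i ≠ j → Disjoint (J i) (J j)) ∧
    (Finset.univ.biUnion J = Finset.univ) ∧
    (∀ i, ∀ a ∈ J i, ∀ b ∈ J i, ¬ G.Adj a b)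

/-- `c_k(G)`: the number of (ordered) `k`-partitions of `G`, with `c_0(G) := 0`. -/
noncomputable def SimpleGraph.ckPart {V : Type*} [Fintype V] [DecidableEq V]
    (G : SimpleGraph V) (k : ℕ) : ℕ :=
  if k = 0 then 0 else Nat.card {J : Fin k → Finset V // G.IsOrderedPartition J}

/-- `c(G) := (-1)^l * ∑_{k=1}^{l} (-1)^k c_k(G)/k`, where `l` is the number of vertices. -/
noncomputable def SimpleGraph.cInv {V : Type*} [Fintype V] [DecidableEq V]
    (G : SimpleGraph V) : ℚ :=
  (-1 : ℚ) ^ (Fintype.card V) *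
    ∑ k ∈ Finset.Icc 1 (Fintype.card V), (-1 : ℚ) ^ k * (G.ckPart k : ℚ) / k

/-- Number of surjections. -/
noncomputable def surjCount (n k : ℕ) : ℕ :=
  Nat.card {f : Fin n → Fin k // Function.Surjective f}

/-- Number of proper surjective colorings. -/
noncomputable def SimpleGraph.surjCol {V : Type*} (G : SimpleGraph V) (k : ℕ) : ℕ :=
  Nat.card {f : V → Fin k // Function.Surjective f ∧ ∀ a b, G.Adj a b → f a ≠ f b}

theorem nat_card_split {α : Type*} [Finite α] (p q r : α → Prop)
    (h : ∀ x, p x ↔ q x ∨ r x) (hd : ∀ x, q x → ¬ r x) :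
    Nat.card {x // p x} = Nat.card {x // q x} + Nat.card {x // r x} := by
  classical
  have := Fintype.ofFinite α
  simp only [Nat.card_eq_fintype_card, Fintype.card_subtype]
  rw [← Finset.card_union_of_disjoint]
  · congr 1
    ext x
    simp [h]
  · rw [Finset.disjoint_filter]
    intro x _
    exact hd x

theorem surjCount_zero_right (n : ℕ) : surjCount n 0 = if n = 0 then 1 else 0 := by
  unfold surjCount
  rcases n with _ | n
  · have : Unique {f : Fin 0 → Fin 0 // Function.Surjective f} :=
      { default := ⟨id, fun x => ⟨x, rfl⟩⟩
        uniq := fun f => Subtype.ext (Subsingleton.elim _ _) }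
    simp
  · have : IsEmpty {f : Fin (n+1) → Fin 0 // Function.Surjective f} :=
      ⟨fun f => (f.1 0).elim0⟩
    simp

theorem surjCount_lt (n : ℕ) : surjCount n (n+1) = 0 := by
  unfold surjCount
  have : IsEmpty {f : Fin n → Fin (n+1) // Function.Surjective f} :=
    ⟨fun f => by simpa using Fintype.card_le_of_surjective f.1 f.2⟩
  simp

theorem surjCount_aux (n k : ℕ) (i : Fin (k+1)) :
    Nat.card {g : Fin n → Fin (k+1) // ∀ j, j ≠ i → ∃ x, g x = j} =
      surjCount n (k+1) + surjCount n k := by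
  rw [nat_card_split (q := fun g => Function.Surjective g)
    (r := fun g : Fin n → Fin (k+1) => (∀ j, j ≠ i → ∃ x, g x = j) ∧ ∀ x, g x ≠ i)]
  · unfold surjCount
    congr 1
    symm
    refine Nat.card_congr (Equiv.ofBijective
      (fun h => ⟨fun x => i.succAbove (h.1 x), ?_, ?_⟩) ⟨?_, ?_⟩)
    · intro j hj
      obtain ⟨y, rfl⟩ := Fin.exists_succAbove_eq hj
      obtain ⟨x, rfl⟩ := h.2 y
      exact ⟨x, rfl⟩
    · intro x
      exact Fin.succAbove_ne _ _
    · intro h h' e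
      ext x : 2
      have := congrFun (congrArg Subtype.val e) x
      exact Fin.succAbove_right_injective this
    · rintro ⟨g, hg, hg'⟩
      choose h hh using fun x => Fin.exists_succAbove_eq (hg' x)
      refine ⟨⟨h, fun y => ?_⟩, ?_⟩
      · obtain ⟨x, hx⟩ := hg _ (Fin.succAbove_ne i y)
        refine ⟨x, ?_⟩
        rw [← hh] at hx
        exact Fin.succAbove_right_injective hx
      · ext x : 2
        exact hh x
  · intro g
    constructor
    · intro h
      by_cases hi : ∃ x, g x = i
      · left
        intro j
        by_cases hj : j = i
        · exact hj ▸ hi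
        · exact h j hj
      · right
        exact ⟨h, fun x hx => hi ⟨x, hx⟩⟩
    · rintro (h | h)
      · exact fun j _ => h j
      · exact h.1
  · rintro g hg ⟨_, h⟩
    obtain ⟨x, hx⟩ := hg i
    exact h x hx

theorem surjCount_succ (n k : ℕ) :
    surjCount (n+1) (k+1) = (k+1) * (surjCount n (k+1) + surjCount n k) := by
  have e : {f : Fin (n+1) → Fin (k+1) // Function.Surjective f} ≃
      Σ i : Fin (k+1), {g : Fin n → Fin (k+1) // ∀ j, j ≠ i → ∃ x, g x = j} :=
    { toFun := fun f => ⟨f.1 0, fun x => f.1 x.succ, fun j hj => by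
        obtain ⟨x, hx⟩ := f.2 j
        rcases Fin.eq_zero_or_eq_succ x with rfl | ⟨y, rfl⟩
        · exact absurd hx.symm hj
        · exact ⟨y, hx⟩⟩
      invFun := fun g => ⟨Fin.cons g.1 g.2.1, fun j => by
        by_cases hj : j = g.1
        · exact ⟨0, by simp [hj]⟩
        · obtain ⟨x, hx⟩ := g.2.2 j hj
          exact ⟨x.succ, by simpa using hx⟩⟩
      left_inv := fun f => by
        ext x : 2
        refine Fin.cases ?_ (fun y => ?_) x <;> simp
      right_inv := fun g => by
        rcases g with ⟨i, g, hg⟩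
        rfl }
  conv_lhs => unfold surjCount
  rw [Nat.card_congr e, Nat.card_sigma]
  simp only [surjCount_aux]
  simp

theorem surj_alt_sum (n m : ℕ) :
    ∑ k ∈ Finset.range m, (-1 : ℚ) ^ (k+1) * (surjCount (n+1) (k+1) : ℚ) / ((k+1 : ℕ) : ℚ) =
      - (surjCount n 0 : ℚ) + (-1) ^ m * surjCount n m := by
  induction m with
  | zero => simp
  | succ m ih =>
    rw [Finset.sum_range_succ, ih, surjCount_succ]
    have : ((m : ℚ) + 1) ≠ 0 := by positivity
    push_cast
    field_simp
    ring

theorem SimpleGraph.ckPart_eq {V : Type*} [Fintype V] [DecidableEq V]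
    (G : SimpleGraph V) (k : ℕ) (hk : k ≠ 0) : G.ckPart k = G.surjCol k := by
  unfold SimpleGraph.ckPart SimpleGraph.surjCol
  rw [if_neg hk]
  symm
  refine Nat.card_congr (Equiv.ofBijective
    (fun f => ⟨fun i => Finset.univ.filter (fun a => f.1 a = i), ?_, ?_, ?_, ?_⟩) ⟨?_, ?_⟩)
  · intro i
    obtain ⟨x, hx⟩ := f.2.1 i
    exact ⟨x, by simpa using hx⟩
  · intro i j hij
    rw [Finset.disjoint_filter]
    rintro x _ rfl h
    exact hij h
  · ext x
    simp
  · intro i a ha b hb hab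
    simp only [Finset.mem_filter, Finset.mem_univ, true_and] at ha hb
    exact f.2.2 a b hab (ha.trans hb.symm)
  · intro f g e
    ext x : 2
    have := congrFun (congrArg Subtype.val e) (g.1 x)
    have h2 := Finset.ext_iff.1 this x
    simpa using h2
  · rintro ⟨J, h1, h2, h3, h4⟩
    have h5 : ∀ x, ∃ i, x ∈ J i := fun x => by
      have := Finset.ext_iff.1 h3 x
      simpa using this
    choose f hf using h5
    have key : ∀ x i, x ∈ J i ↔ f x = i := by
      intro x i
      constructor
      · intro hx
        by_contra hne
        exact Finset.disjoint_left.1 (h2 _ _ hne) (hf x) hx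
      · rintro rfl
        exact hf x
    refine ⟨⟨f, fun i => ?_, fun a b hab e => ?_⟩, ?_⟩
    · obtain ⟨x, hx⟩ := h1 i
      exact ⟨x, (key x i).1 hx⟩
    · exact h4 (f b) a ((key _ _).2 e) b (hf b) hab
    · apply Subtype.ext
      funext i
      ext x
      simp [key]

theorem SimpleGraph.cInv_eq {V : Type*} [Fintype V] [DecidableEq V] (G : SimpleGraph V) :
    G.cInv = (-1 : ℚ) ^ (Fintype.card V) *
      ∑ k ∈ Finset.range (Fintype.card V),
        (-1 : ℚ) ^ (k+1) * (G.surjCol (k+1) : ℚ) / ((k+1 : ℕ) : ℚ) := by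
  unfold SimpleGraph.cInv
  congr 1
  rw [Finset.range_eq_Ico, Finset.sum_Ico_add'
    (fun k : ℕ => (-1 : ℚ) ^ k * (G.surjCol k : ℚ) / (k : ℚ)) 0 _ 1]
  apply Finset.sum_congr
  · ext; simp
  · intro k hk
    simp only [Finset.mem_Ico] at hk
    rw [G.ckPart_eq k (by omega)]

theorem SimpleGraph.surjCol_bot {V : Type*} [Fintype V] (k : ℕ) :
    (⊥ : SimpleGraph V).surjCol k = surjCount (Fintype.card V) k := by
  unfold SimpleGraph.surjCol surjCount
  refine Nat.card_congr (Equiv.subtypeEquiv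
    (Equiv.arrowCongr (Fintype.equivFin V) (Equiv.refl _)) fun f => ?_)
  have : (Equiv.arrowCongr (Fintype.equivFin V) (Equiv.refl (Fin k))) f =
      f ∘ (Fintype.equivFin V).symm := rfl
  rw [this, Equiv.surjective_comp]
  simp

theorem SimpleGraph.cInv_bot {V : Type*} [Fintype V] [DecidableEq V] [Nonempty V] :
    ∃ n : ℕ, (⊥ : SimpleGraph V).cInv = n := by
  obtain ⟨m, hm⟩ := Nat.exists_eq_succ_of_ne_zero (Fintype.card_ne_zero (α := V))
  rw [SimpleGraph.cInv_eq]
  simp only [SimpleGraph.surjCol_bot, hm, Nat.succ_eq_add_one]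
  rw [surj_alt_sum, surjCount_lt, surjCount_zero_right]
  rcases m with _ | m
  · exact ⟨1, by simp⟩
  · exact ⟨0, by simp⟩

/-- Contraction of `b` into `a`. -/
def SimpleGraph.contr {V : Type*} (G : SimpleGraph V) (a b : V) :
    SimpleGraph {x : V // x ≠ b} :=
  SimpleGraph.fromRel fun x y => G.Adj x y ∨ (x.1 = a ∧ G.Adj b y)

theorem SimpleGraph.surjCol_del {V : Type*} [Fintype V] [DecidableEq V] (G : SimpleGraph V)
    (a b : V) (hab : G.Adj a b) (k : ℕ) :
    (G.deleteEdges {s(a, b)}).surjCol k = G.surjCol k + (G.contr a b).surjCol k := by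
  have hne : a ≠ b := hab.ne
  have hdel : ∀ x y, (G.deleteEdges {s(a, b)}).Adj x y ↔
      G.Adj x y ∧ ¬ ((x = a ∧ y = b) ∨ (x = b ∧ y = a)) := by
    intro x y
    simp [SimpleGraph.deleteEdges_adj]
  conv_lhs => unfold SimpleGraph.surjCol
  rw [nat_card_split
    (q := fun f : V → Fin k => Function.Surjective f ∧ ∀ a b, G.Adj a b → f a ≠ f b)
    (r := fun f : V → Fin k => (Function.Surjective f ∧
      ∀ x y, (G.deleteEdges {s(a, b)}).Adj x y → f x ≠ f y) ∧ f a = f b)]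
  · unfold SimpleGraph.surjCol
    congr 1
    refine Nat.card_congr (Equiv.ofBijective
      (fun f => ⟨fun x => f.1 x.1, ?_, ?_⟩) ⟨?_, ?_⟩)
    · intro i
      obtain ⟨x, hx⟩ := f.2.1.1 i
      by_cases hxb : x = b
      · exact ⟨⟨a, hne⟩, by rw [← hx, hxb]; exact f.2.2⟩
      · exact ⟨⟨x, hxb⟩, hx⟩
    · have key : ∀ x y : {x : V // x ≠ b}, x ≠ y → (G.Adj x y ∨ (x.1 = a ∧ G.Adj b y)) →
          f.1 x.1 ≠ f.1 y.1 := by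
        rintro ⟨x, hx⟩ ⟨y, hy⟩ hxy h
        have hxy' : x ≠ y := fun h => hxy (Subtype.ext h)
        rcases h with h | ⟨h1, h2⟩
        · exact f.2.1.2 x y ((hdel _ _).2 ⟨h, by tauto⟩)
        · simp only at h1 h2
          subst h1
          simp only
          rw [f.2.2]
          exact f.2.1.2 b y ((hdel _ _).2 ⟨h2, by tauto⟩)
      intro x y hxy
      rw [SimpleGraph.contr, SimpleGraph.fromRel_adj] at hxy
      rcases hxy with ⟨h, h' | h'⟩
      · exact key x y h h'
      · exact (key y x h.symm h').symm
    · intro f g e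
      have h : ∀ x, x ≠ b → f.1 x = g.1 x := fun x hx =>
        congrFun (congrArg Subtype.val e) ⟨x, hx⟩
      ext x : 2
      by_cases hx : x = b
      · rw [hx, ← f.2.2, ← g.2.2]
        exact h a hne
      · exact h x hx
    · rintro ⟨g, hg, hg'⟩
      have hc : ∀ x y : {x : V // x ≠ b}, x ≠ y → (G.Adj x y ∨ (x.1 = a ∧ G.Adj b y)) →
          g x ≠ g y := fun x y h h' => hg' x y (by
            rw [SimpleGraph.contr, SimpleGraph.fromRel_adj]
            exact ⟨h, Or.inl h'⟩)
      let f : V → Fin k := fun x => if h : x = b then g ⟨a, hne⟩ else g ⟨x, h⟩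
      have fb : f b = g ⟨a, hne⟩ := by simp [f]
      have fx : ∀ x (h : x ≠ b), f x = g ⟨x, h⟩ := fun x h => by simp [f, h]
      refine ⟨⟨f, ⟨fun i => ?_, ?_⟩, ?_⟩, ?_⟩
      · obtain ⟨x, hx⟩ := hg i
        exact ⟨x.1, by rw [fx x.1 x.2, hx]⟩
      · intro x y hxy
        rw [hdel] at hxy
        obtain ⟨hxy, hn⟩ := hxy
        have hxy' := hxy.ne
        by_cases hx : x = b
        · subst hx
          have hy : y ≠ x := hxy'.symm
          rw [fb, fx y hy]
          apply hc
          · intro e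
            have := congrArg Subtype.val e
            simp only at this
            tauto
          · exact Or.inr ⟨rfl, hxy⟩
        · by_cases hy : y = b
          · subst hy
            rw [fb, fx x hx]
            apply Ne.symm
            apply hc
            · intro e
              have := congrArg Subtype.val e
              simp only at this
              tauto
            · exact Or.inr ⟨rfl, hxy.symm⟩
          · rw [fx x hx, fx y hy]
            apply hc
            · intro e
              exact hxy' (congrArg Subtype.val e)
            · exact Or.inl hxy
      · rw [fb, fx a hne]
      · ext x : 2
        exact fx x.1 x.2
  · intro f
    constructor
    · intro h
      by_cases e : f a = f b
      · exact Or.inr ⟨h, e⟩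
      · refine Or.inl ⟨h.1, fun x y hxy => ?_⟩
        by_cases hh : (x = a ∧ y = b) ∨ (x = b ∧ y = a)
        · rcases hh with ⟨rfl, rfl⟩ | ⟨rfl, rfl⟩
          · exact e
          · exact Ne.symm e
        · exact h.2 x y ((hdel x y).2 ⟨hxy, hh⟩)
    · rintro (h | h)
      · exact ⟨h.1, fun x y hxy => h.2 x y ((hdel x y).1 hxy).1⟩
      · exact h.1
  · rintro f h ⟨_, h'⟩
    exact h.2 a b hab h'

theorem SimpleGraph.surjCol_big {V : Type*} [Fintype V] (G : SimpleGraph V) :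
    G.surjCol (Fintype.card V + 1) = 0 := by
  unfold SimpleGraph.surjCol
  have : IsEmpty {f : V → Fin (Fintype.card V + 1) //
      Function.Surjective f ∧ ∀ a b, G.Adj a b → f a ≠ f b} :=
    ⟨fun f => by simpa using Fintype.card_le_of_surjective f.1 f.2.1⟩
  simp

theorem SimpleGraph.cInv_del {V : Type*} [Fintype V] [DecidableEq V] (G : SimpleGraph V)
    (a b : V) (hab : G.Adj a b) :
    G.cInv = (G.deleteEdges {s(a, b)}).cInv + (G.contr a b).cInv := by
  have hcard : Fintype.card V = Fintype.card {x : V // x ≠ b} + 1 := by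
    have h1 : 0 < Fintype.card V := Fintype.card_pos_iff.2 ⟨a⟩
    have h2 : Fintype.card {x : V // x ≠ b} = Fintype.card V - 1 := by simp
    omega
  have hz := (G.contr a b).surjCol_big
  rw [SimpleGraph.cInv_eq, SimpleGraph.cInv_eq, SimpleGraph.cInv_eq, hcard]
  generalize Fintype.card {x : V // x ≠ b} = m at *
  simp only [SimpleGraph.surjCol_del G a b hab]
  have : ∑ k ∈ Finset.range m,
      (-1 : ℚ) ^ (k+1) * ((G.contr a b).surjCol (k+1) : ℚ) / ((k+1 : ℕ) : ℚ) =
      ∑ k ∈ Finset.range (m+1),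
      (-1 : ℚ) ^ (k+1) * ((G.contr a b).surjCol (k+1) : ℚ) / ((k+1 : ℕ) : ℚ) := by
    rw [Finset.sum_range_succ, hz]
    simp
  rw [this]
  simp only [Nat.cast_add (SimpleGraph.surjCol _ _), mul_add, add_div, Finset.sum_add_distrib]
  ring

theorem cInv_aux.{u} (n : ℕ) : ∀ (V : Type u) [Fintype V] [DecidableEq V] [Nonempty V]
    (_ : Fintype.card V = n) (G : SimpleGraph V), ∃ m : ℕ, G.cInv = (m : ℚ) := by
  induction n with
  | zero =>
    intro V _ _ _ h
    exact absurd h Fintype.card_ne_zero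
  | succ n ih =>
    intro V _ _ _ h G
    induction G using WellFoundedLT.induction with
    | ind G ihG =>
      by_cases hG : G = ⊥
      · subst hG
        exact SimpleGraph.cInv_bot
      · obtain ⟨a, b, hab⟩ := SimpleGraph.ne_bot_iff_exists_adj.1 hG
        have : Nonempty {x : V // x ≠ b} := ⟨⟨a, hab.ne⟩⟩
        obtain ⟨p, hp⟩ := ih {x : V // x ≠ b} (by simp [h]) (G.contr a b)
        obtain ⟨q, hq⟩ := ihG (G.deleteEdges {s(a, b)}) (by
          refine lt_of_le_of_ne (SimpleGraph.deleteEdges_le _) fun e => ?_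
          rw [← e] at hab
          simp [SimpleGraph.deleteEdges_adj] at hab)
        refine ⟨q + p, ?_⟩
        rw [G.cInv_del a b hab, hp, hq]
        push_cast
        rfl

/-- **Nonnegative integrality.** For every finite simple graph `G` on at least one vertex,
`c(G)` is a nonnegative integer. -/
theorem cInv_is_nonneg_integer {V : Type*} [Fintype V] [DecidableEq V] [Nonempty V]
    (G : SimpleGraph V) :
    ∃ n : ℕ, G.cInv = (n : ℚ) := by
  exact cInv_aux _ V rfl G
end
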